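/- arXiv:1002.4604 — 4 statements merged into one kernel-verified Lean document; each statement's English description precedes it below -/
import Mathlib

section
/- Let X and Y be classes of objects in a triangulated category T such that the pair (X, Y) is a co-t-structure on the smallest thick subcategory Δ̄_T(X) of T containing X. Then Δ̄_T(X) = X^∧ and (X, Y) is a relative Auslander–Buchweitz context on T. -/
open CategoryTheory CategoryTheory.Limits CategoryTheory.Pretriangulated

universe v u

variable (C : Type u) [Category.{v} C] [HasZeroObject C] [HasShift C ℤ]
  [Preadditive C] [∀ n : ℤ, (CategoryTheory.shiftFunctor C n).Additive]
  [Pretriangulated C]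

namespace CotPaper

variable {C}

/-- The shift `X⟦n⟧` of a class of objects `X` by `n ∈ ℤ`, closed under isomorphism. -/
def shf (X : Set C) (n : ℤ) : Set C := {Z | ∃ A ∈ X, Nonempty (Z ≅ A⟦n⟧)}

/-- `star X Y` consists of the objects `Z` fitting in a distinguished triangle
`A ⟶ Z ⟶ B ⟶ A⟦1⟧` with `A ∈ X` and `B ∈ Y`. -/
def star (X Y : Set C) : Set C :=
  {Z | ∃ (A B : C) (f : A ⟶ Z) (g : Z ⟶ B) (h : B ⟶ A⟦(1:ℤ)⟧),
    A ∈ X ∧ B ∈ Y ∧ Triangle.mk f g h ∈ distTriang C}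

/-- `X^⊥ = {Z : Hom(X', Z) = 0 for all X' ∈ X}`. -/
def rightOrth (X : Set C) : Set C := {Z | ∀ A ∈ X, ∀ f : A ⟶ Z, f = 0}

/-- `⊥X = {Z : Hom(Z, X') = 0 for all X' ∈ X}`. -/
def leftOrth (X : Set C) : Set C := {Z | ∀ B ∈ X, ∀ f : Z ⟶ B, f = 0}

/-- A class of objects is closed under isomorphisms. -/
def isoClosed (X : Set C) : Prop := ∀ ⦃A B : C⦄, A ∈ X → (A ≅ B) → B ∈ X

/-- A class of objects is closed under direct summands. -/
def summandClosed (X : Set C) : Prop :=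
  ∀ ⦃W Z : C⦄, W ∈ X → (∃ (i : Z ⟶ W) (r : W ⟶ Z), i ≫ r = 𝟙 Z) → Z ∈ X

/-- `W` is a direct sum of `A` and `B` (i.e. carries a binary biproduct structure). -/
def isDirectSum (W A B : C) : Prop :=
  ∃ (iA : A ⟶ W) (iB : B ⟶ W) (pA : W ⟶ A) (pB : W ⟶ B),
    iA ≫ pA = 𝟙 A ∧ iB ≫ pB = 𝟙 B ∧ iA ≫ pB = 0 ∧ iB ≫ pA = 0 ∧
      pA ≫ iA + pB ≫ iB = 𝟙 W

/-- An additive class of objects: it contains a zero object and is closed under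
finite (binary) direct sums. -/
def addClosed (X : Set C) : Prop :=
  (∃ Z ∈ X, IsZero Z) ∧ ∀ ⦃A B W : C⦄, A ∈ X → B ∈ X → isDirectSum W A B → W ∈ X

/-- `X = add X` : `X` is closed under isomorphisms, finite direct sums and direct summands. -/
def isAdd (X : Set C) : Prop := isoClosed X ∧ addClosed X ∧ summandClosed X

/-- A class is suspended if it is closed under `[1]` and under extensions. -/
def suspended (X : Set C) : Prop := shf X 1 ⊆ X ∧ star X X ⊆ X

/-- A class is cosuspended if it is closed under `[-1]` and under extensions. -/
def cosuspended (X : Set C) : Prop := shf X (-1) ⊆ X ∧ star X X ⊆ X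

/-- `ε^∧_n(X)`: defined inductively, `ε^∧_0(X) = X` and `Z ∈ ε^∧_{n+1}(X)` iff there is a
distinguished triangle `Z⟦-1⟧ ⟶ W ⟶ A ⟶ Z` (equivalently `W ⟶ A ⟶ Z ⟶ W⟦1⟧`) with
`W ∈ ε^∧_n(X)` and `A ∈ X`. -/
def epsHat (X : Set C) : ℕ → Set C
  | 0 => X
  | n + 1 =>
    {Z | ∃ (W A : C) (f : W ⟶ A) (g : A ⟶ Z) (h : Z ⟶ W⟦(1:ℤ)⟧),
      W ∈ epsHat X n ∧ A ∈ X ∧ Triangle.mk f g h ∈ distTriang C}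

/-- `ε^∨_n(X)`: `ε^∨_0(X) = X` and `Z ∈ ε^∨_{n+1}(X)` iff there is a distinguished
triangle `Z ⟶ A ⟶ K ⟶ Z⟦1⟧` with `A ∈ X` and `K ∈ ε^∨_n(X)`. -/
def epsCheck (X : Set C) : ℕ → Set C
  | 0 => X
  | n + 1 =>
    {Z | ∃ (A K : C) (f : Z ⟶ A) (g : A ⟶ K) (h : K ⟶ Z⟦(1:ℤ)⟧),
      A ∈ X ∧ K ∈ epsCheck X n ∧ Triangle.mk f g h ∈ distTriang C}

/-- `X^∧ := ∪_{n ≥ 0} ε^∧_n(X)`. -/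
def hat (X : Set C) : Set C := ⋃ n : ℕ, epsHat X n

/-- `X^∨ := ∪_{n ≥ 0} ε^∨_n(X)`. -/
def check (X : Set C) : Set C := ⋃ n : ℕ, epsCheck X n

/-- `X~ := (X^∧)^∨`. -/
def tilde (X : Set C) : Set C := check (hat X)

/-- `resdim_X(M) := min {n : M ∈ ε^∧_n(X)}`, with `min ∅ = ∞`. -/
noncomputable def resdim (X : Set C) (M : C) : ℕ∞ :=
  sInf {n : ℕ∞ | ∃ m : ℕ, n = (m : ℕ∞) ∧ M ∈ epsHat X m}

/-- `coresdim_X(M) := min {n : M ∈ ε^∨_n(X)}`, with `min ∅ = ∞`. -/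
noncomputable def coresdim (X : Set C) (M : C) : ℕ∞ :=
  sInf {n : ℕ∞ | ∃ m : ℕ, n = (m : ℕ∞) ∧ M ∈ epsCheck X m}

/-- `id_X(M) := min {n ∈ ℕ : Hom(-, M[i])|_X = 0 for all i > n}`, with `min ∅ = ∞`. -/
noncomputable def idDim (X : Set C) (M : C) : ℕ∞ :=
  sInf {n : ℕ∞ | ∃ m : ℕ, n = (m : ℕ∞) ∧
    ∀ i : ℤ, (m : ℤ) < i → ∀ A ∈ X, ∀ f : A ⟶ M⟦i⟧, f = 0}

/-- `pd_X(M) := min {n ∈ ℕ : Hom(M[-i], -)|_X = 0 for all i > n}`, with `min ∅ = ∞`. -/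
noncomputable def pdDim (X : Set C) (M : C) : ℕ∞ :=
  sInf {n : ℕ∞ | ∃ m : ℕ, n = (m : ℕ∞) ∧
    ∀ i : ℤ, (m : ℤ) < i → ∀ B ∈ X, ∀ f : M⟦(-i : ℤ)⟧ ⟶ B, f = 0}

/-- `id_X(Y) := sup {id_X(M) : M ∈ Y}`. -/
noncomputable def idDimSet (X Y : Set C) : ℕ∞ := ⨆ M ∈ Y, idDim X M

/-- `pd_X(Y) := sup {pd_X(M) : M ∈ Y}`. -/
noncomputable def pdDimSet (X Y : Set C) : ℕ∞ := ⨆ M ∈ Y, pdDim X M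

/-- `ω` is `X`-injective: `id_X(W) = 0` for every `W ∈ ω`. -/
def xInjective (X ω : Set C) : Prop := ∀ W ∈ ω, idDim X W = 0

/-- `ω` is `X`-projective: `pd_X(W) = 0` for every `W ∈ ω`. -/
def xProjective (X ω : Set C) : Prop := ∀ W ∈ ω, pdDim X W = 0

/-- `ω` is a weak-cogenerator in `X`: `ω ⊆ X ⊆ X[-1] * ω`. -/
def weakCogenerator (ω X : Set C) : Prop := ω ⊆ X ∧ X ⊆ star (shf X (-1)) ω

/-- `ω` is a weak-generator in `X`: `ω ⊆ X ⊆ ω * X[1]`. -/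
def weakGenerator (ω X : Set C) : Prop := ω ⊆ X ∧ X ⊆ star ω (shf X 1)

/-- `ω` is silting: `Hom(W, W'[i]) = 0` for all `W, W' ∈ ω` and all `i > 0`. -/
def silting (ω : Set C) : Prop :=
  ∀ W ∈ ω, ∀ W' ∈ ω, ∀ i : ℤ, 0 < i → ∀ f : W ⟶ W'⟦i⟧, f = 0

/-- A thick subcategory: a (full, additive, isomorphism-closed) triangulated subcategory
closed under direct summands. -/
structure IsThick (S : Set C) : Prop where
  zero : ∃ Z ∈ S, IsZero Z
  iso : isoClosed S
  shift : ∀ n : ℤ, shf S n ⊆ S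
  ext : star S S ⊆ S
  summand : summandClosed S

/-- `Δ̄_T(X)`: the smallest thick subcategory containing `X`. -/
def thickClosure (X : Set C) : Set C := ⋂₀ {S : Set C | IsThick S ∧ X ⊆ S}

/-- `U_ω`: the smallest suspended class containing `ω`. -/
def uPlus (ω : Set C) : Set C := ⋂₀ {S : Set C | suspended S ∧ ω ⊆ S}

/-- `_ωU`: the smallest cosuspended class containing `ω`. -/
def uMinus (ω : Set C) : Set C := ⋂₀ {S : Set C | cosuspended S ∧ ω ⊆ S}

/-- `_ωŪ`: the smallest cosuspended class containing `ω` closed under direct summands. -/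
def uMinusBar (ω : Set C) : Set C :=
  ⋂₀ {S : Set C | cosuspended S ∧ summandClosed S ∧ ω ⊆ S}

/-- `(A, B)` is a co-t-structure on the triangulated subcategory `S` of `C`:
`A` and `B` are full additive subcategories of `S` closed under isomorphisms and direct
summands, `A[-1] ⊆ A`, `B[1] ⊆ B`, `Hom(A[-1], B) = 0` and `S = A[-1] * B`. -/
structure IsCotStructure (S A B : Set C) : Prop where
  subA : A ⊆ S
  subB : B ⊆ S
  isoA : isoClosed A
  isoB : isoClosed B
  addA : addClosed A
  addB : addClosed B
  summandA : summandClosed A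
  summandB : summandClosed B
  shiftA : shf A (-1) ⊆ A
  shiftB : shf B 1 ⊆ B
  orth : ∀ A' ∈ shf A (-1), ∀ B' ∈ B, ∀ f : A' ⟶ B', f = 0
  decomp : S = star (shf A (-1)) B

/-- A relative Auslander-Buchweitz context on `C` : `X` is cosuspended and closed under
direct summands, `Y` is suspended, closed under direct summands and `Y ⊆ X^∧`, and
`ω := X ∩ Y` is an `X`-injective weak-cogenerator in `X`. -/
structure RelativeABContext (X Y : Set C) : Prop where
  cosusp : cosuspended X
  summandX : summandClosed X
  susp : suspended Y
  summandY : summandClosed Y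
  sub : Y ⊆ hat X
  inj : xInjective X (X ∩ Y)
  wcog : weakCogenerator (X ∩ Y) X


lemma star_of_dist {X Y : Set C} (T : Triangle C) (hT : T ∈ distTriang C)
    (h1 : T.obj₁ ∈ X) (h3 : T.obj₃ ∈ Y) : T.obj₂ ∈ star X Y :=
  ⟨T.obj₁, T.obj₃, T.mor₁, T.mor₂, T.mor₃, h1, h3, hT⟩

lemma thickClosure_isThick (X : Set C) (hX : ∃ Z ∈ X, IsZero Z) : IsThick (thickClosure X) where
  zero := by
    obtain ⟨Z, hZ, h0⟩ := hX
    exact ⟨Z, fun S hS => hS.2 hZ, h0⟩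
  iso := fun A B hA e S hS => hS.1.iso (hA S hS) e
  shift := by
    rintro n Z ⟨A, hA, e⟩ S hS
    exact hS.1.shift n ⟨A, hA S hS, e⟩
  ext := by
    rintro Z ⟨A, B, f, g, k, hA, hB, hT⟩ S hS
    exact hS.1.ext ⟨A, B, f, g, k, hA S hS, hB S hS, hT⟩
  summand := fun W Z hW hr S hS => hS.1.summand (hW S hS) hr

lemma shift_le {X : Set C} (hiso : isoClosed X) (hsh : shf X (-1) ⊆ X) (Z : C) (a b : ℤ)
    (hab : b ≤ a) (h : Z⟦a⟧ ∈ X) : Z⟦b⟧ ∈ X := by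
  obtain ⟨k, rfl⟩ : ∃ k : ℕ, b = a - k := ⟨(a - b).toNat, by omega⟩
  clear hab
  induction k with
  | zero => exact hiso h (eqToIso (by simp))
  | succ k ih =>
    refine hsh ⟨_, ih, ⟨?_⟩⟩
    exact (shiftFunctorAdd' C (a - (k : ℤ)) (-1) (a - ((k + 1 : ℕ) : ℤ)) (by push_cast; ring)).app Z

lemma star_shift {X : Set C} (hX : star X X ⊆ X) (m : ℤ) (T : Triangle C) (hT : T ∈ distTriang C)
    (h1 : T.obj₁⟦m⟧ ∈ X) (h3 : T.obj₃⟦m⟧ ∈ X) : T.obj₂⟦m⟧ ∈ X :=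
  hX (star_of_dist ((Triangle.shiftFunctor C m).obj T) (Triangle.shift_distinguished T hT m) h1 h3)

/-- The union of all nonnegative shifts of `X`. -/
def unionShift (X : Set C) : Set C := {Z | ∃ n : ℕ, Z⟦(-(n : ℤ))⟧ ∈ X}

lemma unionShift_isThick {X : Set C} (hiso : isoClosed X) (hsh : shf X (-1) ⊆ X)
    (hX : star X X ⊆ X) (hsum : summandClosed X) (h0 : ∃ Z ∈ X, IsZero Z) :
    IsThick (unionShift X) where
  zero := by
    obtain ⟨Z, hZ, hz⟩ := h0
    exact ⟨Z, ⟨0, hiso hZ ((hz.iso ((shiftFunctor C (-((0:ℕ):ℤ))).map_isZero hz)))⟩, hz⟩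
  iso := by
    rintro A B ⟨n, hn⟩ e
    exact ⟨n, hiso hn ((shiftFunctor C _).mapIso e)⟩
  shift := by
    rintro k Z ⟨A, ⟨n, hn⟩, ⟨e⟩⟩
    refine ⟨n + k.natAbs, ?_⟩
    have := shift_le hiso hsh A (-(n : ℤ)) (k + (-((n + k.natAbs : ℕ) : ℤ))) (by omega) hn
    refine hiso this ?_
    exact (shiftFunctorAdd' C k (-((n + k.natAbs : ℕ) : ℤ)) _ rfl).app A ≪≫
      (shiftFunctor C _).mapIso e.symm
  ext := by
    rintro Z ⟨A, B, f, g, k, ⟨n, hA⟩, ⟨m, hB⟩, hT⟩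
    refine ⟨n + m, ?_⟩
    exact star_shift hX _ _ hT (shift_le hiso hsh A _ _ (by push_cast; omega) hA)
      (shift_le hiso hsh B _ _ (by push_cast; omega) hB)
  summand := by
    rintro W Z ⟨n, hn⟩ ⟨i, r, hir⟩
    refine ⟨n, hsum hn ⟨(shiftFunctor C _).map i, (shiftFunctor C _).map r, ?_⟩⟩
    rw [← Functor.map_comp, hir, CategoryTheory.Functor.map_id]

lemma unionShift_sub {X : Set C} (hiso : isoClosed X) (h0 : ∃ Z ∈ X, IsZero Z) (n : ℕ) :
    ∀ Z : C, Z⟦(-(n : ℤ))⟧ ∈ X → Z ∈ epsHat X n := by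
  induction n with
  | zero =>
    intro Z hZ
    exact hiso hZ ((shiftFunctorZero' C (-((0:ℕ):ℤ)) (by simp)).app Z)
  | succ n ih =>
    intro Z hZ
    have h1 : Z⟦(-1 : ℤ)⟧ ∈ epsHat X n := ih _ (hiso hZ
      ((shiftFunctorAdd' C (-1) (-(n : ℤ)) (-((n + 1 : ℕ) : ℤ)) (by push_cast; ring)).app Z))
    let T := (contractibleTriangle Z).invRotate.invRotate
    have hT : T ∈ distTriang C :=
      inv_rot_of_distTriang _ (inv_rot_of_distTriang _ (contractible_distinguished Z))
    refine ⟨T.obj₁, T.obj₂, T.mor₁, T.mor₂, T.mor₃, h1, ?_, hT⟩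
    obtain ⟨O, hO, hz⟩ := h0
    exact hiso hO (hz.iso ((shiftFunctor C (-1 : ℤ)).map_isZero (isZero_zero C)))

section

variable {X Y : Set C} (h : IsCotStructure (thickClosure X) X Y)
include h

lemma cot_thick : IsThick (thickClosure X) := thickClosure_isThick X h.addA.1

lemma cot_orth {A B : C} (hA : A ∈ X) (hB : B ∈ Y) (f : A⟦(-1 : ℤ)⟧ ⟶ B) : f = 0 :=
  h.orth _ ⟨A, hA, ⟨Iso.refl _⟩⟩ B hB f

lemma cot_memX {Z : C} (hZ : Z ∈ thickClosure X)
    (hf : ∀ B ∈ Y, ∀ f : Z⟦(-1 : ℤ)⟧ ⟶ B, f = 0) : Z ∈ X := by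
  have h1 : Z⟦(-1 : ℤ)⟧ ∈ thickClosure X := (cot_thick h).shift (-1) ⟨Z, hZ, ⟨Iso.refl _⟩⟩
  rw [h.decomp] at h1
  obtain ⟨A', B, f, g, k, ⟨A, hA, ⟨e⟩⟩, hB, hT⟩ := h1
  obtain ⟨s, hs⟩ := Triangle.coyoneda_exact₂ _ hT (𝟙 (Z⟦(-1 : ℤ)⟧))
    (by rw [hf B hB g]; exact comp_zero)
  obtain ⟨s, hs'⟩ : ∃ s : Z⟦(-1 : ℤ)⟧ ⟶ A', 𝟙 (Z⟦(-1 : ℤ)⟧) = s ≫ f := ⟨s, hs⟩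
  let i : Z⟦(-1 : ℤ)⟧ ⟶ A⟦(-1 : ℤ)⟧ := s ≫ e.hom
  let r : A⟦(-1 : ℤ)⟧ ⟶ Z⟦(-1 : ℤ)⟧ := e.inv ≫ f
  have hir : i ≫ r = 𝟙 _ := by simp [i, r, hs']
  refine h.summandA hA ⟨(shiftFunctor C (-1 : ℤ)).preimage i, (shiftFunctor C (-1 : ℤ)).preimage r, ?_⟩
  apply (shiftFunctor C (-1 : ℤ)).map_injective
  simp [hir]

lemma cot_memY {Z : C} (hZ : Z ∈ thickClosure X)
    (hf : ∀ A ∈ X, ∀ f : A⟦(-1 : ℤ)⟧ ⟶ Z, f = 0) : Z ∈ Y := by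
  have h1 := hZ
  rw [h.decomp] at h1
  obtain ⟨A', B, f, g, k, ⟨A, hA, ⟨e⟩⟩, hB, hT⟩ := h1
  have hf0 : f = 0 := by
    have := hf A hA (e.inv ≫ f)
    rw [← cancel_epi e.inv, this, comp_zero]
  obtain ⟨s, hs⟩ := Triangle.yoneda_exact₂ _ hT (𝟙 Z) (by rw [hf0]; exact zero_comp)
  exact h.summandB hB ⟨g, s, hs.symm⟩

lemma cot_extX : star X X ⊆ X := by
  rintro Z ⟨A, B, f, g, k, hA, hB, hT⟩
  refine cot_memX h ((cot_thick h).ext ⟨A, B, f, g, k, h.subA hA, h.subA hB, hT⟩) ?_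
  intro W hW p
  obtain ⟨s, hs⟩ := Triangle.yoneda_exact₂ _ (Triangle.shift_distinguished _ hT (-1)) p
    (cot_orth h hA hW _)
  rw [hs, show s = 0 from cot_orth h hB hW s]; exact comp_zero

lemma cot_extY : star Y Y ⊆ Y := by
  rintro Z ⟨A, B, f, g, k, hA, hB, hT⟩
  refine cot_memY h ((cot_thick h).ext ⟨A, B, f, g, k, h.subB hA, h.subB hB, hT⟩) ?_
  intro W hW p
  obtain ⟨s, hs⟩ := Triangle.coyoneda_exact₂ _ hT p (cot_orth h hW hB _)
  rw [hs, show s = 0 from cot_orth h hW hA s]; exact zero_comp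

lemma cot_shiftY {W : C} (hW : W ∈ Y) (n : ℕ) : W⟦(n : ℤ)⟧ ∈ Y := by
  induction n with
  | zero => exact h.isoB hW ((shiftFunctorZero' C ((0:ℕ):ℤ) (by simp)).app W).symm
  | succ n ih =>
    exact h.shiftB ⟨_, ih, ⟨(shiftFunctorAdd' C (n : ℤ) 1 ((n + 1 : ℕ) : ℤ) (by push_cast; ring)).app W⟩⟩

lemma cot_eq : thickClosure X = hat X := by
  apply Set.Subset.antisymm
  · intro Z hZ
    have : Z ∈ unionShift X := hZ _ ⟨unionShift_isThick h.isoA h.shiftA (cot_extX h) h.summandA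
      h.addA.1, fun A hA => ⟨0, h.isoA hA ((shiftFunctorZero' C (-((0:ℕ):ℤ)) (by simp)).app A).symm⟩⟩
    obtain ⟨n, hn⟩ := this
    exact Set.mem_iUnion.2 ⟨n, unionShift_sub h.isoA h.addA.1 n Z hn⟩
  · intro Z hZ
    obtain ⟨n, hn⟩ := Set.mem_iUnion.1 hZ
    clear hZ
    induction n generalizing Z with
    | zero => exact h.subA hn
    | succ n ih =>
      obtain ⟨W, A, f, g, k, hW, hA, hT⟩ := hn
      exact (cot_thick h).ext (star_of_dist _ (rot_of_distTriang _ hT) (h.subA hA)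
        ((cot_thick h).shift 1 ⟨W, ih hW, ⟨Iso.refl _⟩⟩))

end

/-- If `(X, Y)` is a co-t-structure on the smallest thick subcategory
`Δ̄_T(X)` of `T` containing `X`, then `Δ̄_T(X) = X^∧` and `(X, Y)` is a relative
Auslander-Buchweitz context on `T`. -/
theorem stmt1 (X Y : Set C) (h : IsCotStructure (thickClosure X) X Y) :
    thickClosure X = hat X ∧ RelativeABContext X Y := by
  refine ⟨cot_eq h, ⟨h.shiftA, cot_extX h⟩, h.summandA, ⟨h.shiftB, cot_extY h⟩, h.summandB,
    ?_, ?_, fun _ hZ => hZ.1, ?_⟩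
  · rw [← cot_eq h]; exact h.subB
  · rintro W ⟨-, hW⟩
    refine le_antisymm (sInf_le ⟨0, by simp, ?_⟩) bot_le
    intro i hi A hA f
    obtain ⟨n, rfl⟩ : ∃ n : ℕ, i = n + 1 := ⟨(i - 1).toNat, by omega⟩
    apply (shiftFunctor C (-1 : ℤ)).map_injective
    let e := (shiftFunctorAdd' C ((n : ℤ) + 1) (-1) (n : ℤ) (by ring)).app W
    have := cot_orth h hA (cot_shiftY h hW n) ((shiftFunctor C (-1 : ℤ)).map f ≫ e.inv)
    rw [Functor.map_zero, ← cancel_mono e.inv, this, zero_comp]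
  · intro Z hZ
    have h1 := h.subA hZ
    rw [h.decomp] at h1
    obtain ⟨A', B, f, g, k, ⟨A, hA, ⟨e⟩⟩, hB, hT⟩ := h1
    refine ⟨A', B, f, g, k, ⟨A, hA, ⟨e⟩⟩, ⟨?_, hB⟩, hT⟩
    refine cot_extX h (star_of_dist _ (rot_of_distTriang _ hT) hZ ?_)
    refine h.isoA hA ?_
    exact ((shiftFunctor C (1 : ℤ)).mapIso e ≪≫
      (shiftFunctorCompIsoId C (-1 : ℤ) 1 (by simp)).app A).symm

end CotPaper
end

section
/- Let R be a commutative artinian ring and T an R-linear triangulated category which is Hom-finite (each Hom-group is a finitely generated R-module) and Krull–Schmidt (every object is a finite direct sum of indecomposables with local endomorphism rings). Then the assignment X ↦ (X, X^⊥[-1] ∩ X^∧) is a bijection between: (i) cosuspended subcategories X of T with X = add(X) which are precovering in X^∧, and (ii) pairs (X, Y) which are co-t-structures on Δ̄_T(X); its inverse sends (X, Y) to X. -/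
open CategoryTheory CategoryTheory.Limits CategoryTheory.Pretriangulated

universe v u

variable (C : Type u) [Category.{v} C] [HasZeroObject C] [HasShift C ℤ]
  [Preadditive C] [∀ n : ℤ, (CategoryTheory.shiftFunctor C n).Additive]
  [Pretriangulated C]

namespace CotPaper

variable {C}

/-- `X` is a precovering class in `Y`: every `M ∈ Y` admits an `X`-precover. -/
def precoveringIn (X Y : Set C) : Prop :=
  ∀ M ∈ Y, ∃ (X' : C) (f : X' ⟶ M), X' ∈ X ∧
    ∀ (X'' : C), X'' ∈ X → ∀ g : X'' ⟶ M, ∃ h : X'' ⟶ X', h ≫ f = g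

/-- An object `Z` is indecomposable: it is nonzero and in any direct sum decomposition
`Z = A ⊕ B` one of the summands is zero. -/
def IsIndecomposable (Z : C) : Prop :=
  ¬ IsZero Z ∧ ∀ A B : C, isDirectSum Z A B → IsZero A ∨ IsZero B

/-- `Z` is the direct sum of the objects in the list `l`. -/
def isFiniteDirectSum : C → List C → Prop
  | Z, [] => IsZero Z
  | Z, A :: l => ∃ W : C, isDirectSum Z A W ∧ isFiniteDirectSum W l

variable (C) in
/-- The category `C` is Krull-Schmidt: every object is a finite direct sum of
indecomposable objects with local endomorphism rings. -/
def KrullSchmidt : Prop :=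
  ∀ Z : C, ∃ l : List C, isFiniteDirectSum Z l ∧
    ∀ A ∈ l, IsIndecomposable A ∧ IsLocalRing (End A)

set_option linter.unusedSectionVars false

noncomputable def shIso (A : C) (a b c : ℤ) (h : a + b = c) : A⟦a⟧⟦b⟧ ≅ A⟦c⟧ :=
  ((shiftFunctorAdd' C a b c h).app A).symm

theorem hom_zero_up {A B : C} (h : ∀ f : A⟦(-1:ℤ)⟧ ⟶ B, f = 0) (g : A ⟶ B⟦(1:ℤ)⟧) : g = 0 := by
  have h1 := h (g⟦(-1:ℤ)⟧' ≫ (shIso B 1 (-1) 0 (by norm_num) ≪≫ (shiftFunctorZero C ℤ).app B).hom)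
  have h2 : g⟦(-1:ℤ)⟧' = 0 := by
    rw [← cancel_mono (shIso B 1 (-1) 0 (by norm_num) ≪≫ (shiftFunctorZero C ℤ).app B).hom, h1,
      zero_comp]
  apply (shiftFunctor C (-1:ℤ)).map_injective
  rw [h2, Functor.map_zero]

theorem hom_zero_down {A B : C} (h : ∀ f : A ⟶ B⟦(1:ℤ)⟧, f = 0) (g : A⟦(-1:ℤ)⟧ ⟶ B) : g = 0 := by
  have h1 := h ((shIso A (-1) 1 0 (by norm_num) ≪≫ (shiftFunctorZero C ℤ).app A).inv ≫ g⟦(1:ℤ)⟧')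
  have h2 : g⟦(1:ℤ)⟧' = 0 := by
    rw [← cancel_epi (shIso A (-1) 1 0 (by norm_num) ≪≫ (shiftFunctorZero C ℤ).app A).inv, h1,
      comp_zero]
  apply (shiftFunctor C (1:ℤ)).map_injective
  rw [h2, Functor.map_zero]

theorem rightOrth_iso (X : Set C) : isoClosed (rightOrth X) := by
  intro A B hA e D hD f
  have := hA D hD (f ≫ e.inv)
  rw [← cancel_mono e.inv, this, zero_comp]

theorem mem_shf_iff {X : Set C} (hX : isoClosed X) (n m : ℤ) (h : n + m = 0) (Z : C) :
    Z ∈ shf X n ↔ Z⟦m⟧ ∈ X := by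
  constructor
  · rintro ⟨A, hA, ⟨e⟩⟩
    exact hX hA (((shiftFunctor C m).mapIso e ≪≫ shIso A n m 0 h ≪≫
      (shiftFunctorZero C ℤ).app A).symm)
  · intro hZ
    exact ⟨Z⟦m⟧, hZ, ⟨(shIso Z m n 0 (by omega) ≪≫ (shiftFunctorZero C ℤ).app Z).symm⟩⟩

theorem star_iso (P Q : Set C) {Z Z' : C} (h : Z ∈ star P Q) (e : Z ≅ Z') : Z' ∈ star P Q := by
  obtain ⟨A, B, f, g, h, hA, hB, hT⟩ := h
  refine ⟨A, B, f ≫ e.hom, e.inv ≫ g, h, hA, hB, ?_⟩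
  refine isomorphic_distinguished _ hT _ ?_
  refine Triangle.isoMk _ _ (Iso.refl _) e.symm (Iso.refl _) ?_ ?_ ?_
  · change (f ≫ e.hom) ≫ e.inv = 𝟙 A ≫ f
    simp
  · change (e.inv ≫ g) ≫ 𝟙 B = e.inv ≫ g
    simp
  · change h ≫ (𝟙 A)⟦(1:ℤ)⟧' = 𝟙 B ≫ h
    simp

theorem exact₂ {A Z B : C} {f : A ⟶ Z} {g : Z ⟶ B} {h : B ⟶ A⟦(1:ℤ)⟧}
    (hT : Triangle.mk f g h ∈ distTriang C) {D : C} (k : D ⟶ Z) (hk : k ≫ g = 0) :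
    ∃ l : D ⟶ A, l ≫ f = k := by
  obtain ⟨l, hl⟩ := Triangle.coyoneda_exact₂ _ hT k hk
  exact ⟨l, hl.symm⟩

theorem exact₃ {A Z B : C} {f : A ⟶ Z} {g : Z ⟶ B} {h : B ⟶ A⟦(1:ℤ)⟧}
    (hT : Triangle.mk f g h ∈ distTriang C) {D : C} (k : D ⟶ B) (hk : k ≫ h = 0) :
    ∃ l : D ⟶ Z, l ≫ g = k := by
  obtain ⟨l, hl⟩ := Triangle.coyoneda_exact₃ _ hT k hk
  exact ⟨l, hl.symm⟩

theorem coexact₂ {A Z B : C} {f : A ⟶ Z} {g : Z ⟶ B} {h : B ⟶ A⟦(1:ℤ)⟧}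
    (hT : Triangle.mk f g h ∈ distTriang C) {D : C} (k : Z ⟶ D) (hk : f ≫ k = 0) :
    ∃ l : B ⟶ D, g ≫ l = k := by
  obtain ⟨l, hl⟩ := Triangle.yoneda_exact₂ _ hT k hk
  exact ⟨l, hl.symm⟩

theorem star_shift_s2 {P Q P' Q' : Set C} {Z : C} (h : Z ∈ star P Q) (n : ℤ)
    (hP : ∀ A ∈ P, A⟦n⟧ ∈ P') (hQ : ∀ A ∈ Q, A⟦n⟧ ∈ Q') : Z⟦n⟧ ∈ star P' Q' := by
  obtain ⟨A, B, f, g, h, hA, hB, hT⟩ := h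
  exact ⟨A⟦n⟧, B⟦n⟧, _, _, _, hP A hA, hQ B hB, Triangle.shift_distinguished _ hT n⟩

theorem star_of_directSum {P Q : Set C} {W A B : C} (h : isDirectSum W A B)
    (hA : A ∈ P) (hB : B ∈ Q) : W ∈ star P Q := by
  obtain ⟨iA, iB, pA, pB, h1, h2, h3, h4, h5⟩ := h
  have hT := binaryBiproductTriangle_distinguished A B
  refine star_iso P Q (Z := A ⊞ B) ⟨A, B, _, _, _, hA, hB, hT⟩ ?_
  refine ⟨biprod.desc iA iB, biprod.lift pA pB, ?_, ?_⟩
  · ext <;> simp [h1, h2, h3, h4]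
  · simp [h5]

theorem thickClosure_thick (X : Set C) : IsThick (thickClosure X) where
  zero := by
    refine ⟨(HasZeroObject.zero' C).zero, ?_, isZero_zero C⟩
    rintro S ⟨hS, -⟩
    obtain ⟨Z, hZ, h0⟩ := hS.zero
    exact hS.iso hZ (h0.iso (isZero_zero C))
  iso := fun A B hA e S hS => hS.1.iso (hA S hS) e
  shift := by
    rintro n Z ⟨A, hA, e⟩ S hS
    exact hS.1.shift n ⟨A, hA S hS, e⟩
  ext := by
    rintro Z ⟨A, B, f, g, h, hA, hB, hT⟩ S hS
    exact hS.1.ext ⟨A, B, f, g, h, hA S hS, hB S hS, hT⟩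
  summand := fun A B hA e S hS => hS.1.summand (hA S hS) e

theorem subset_thickClosure (X : Set C) : X ⊆ thickClosure X := fun _ hA _ hS => hS.2 hA

theorem IsThick.sh {S : Set C} (hS : IsThick S) {A : C} (hA : A ∈ S) (n : ℤ) : A⟦n⟧ ∈ S :=
  hS.shift n ⟨A, hA, ⟨Iso.refl _⟩⟩

theorem hat_subset (X : Set C) : hat X ⊆ thickClosure X := by
  intro Z hZ
  obtain ⟨n, hn⟩ := Set.mem_iUnion.1 hZ
  have ht := thickClosure_thick X
  induction n generalizing Z with
  | zero => exact subset_thickClosure X hn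
  | succ n ih =>
    obtain ⟨W, A, f, g, h, hW, hA, hT⟩ := hn
    have hW' := ih (Set.mem_iUnion.2 ⟨n, hW⟩) hW
    exact ht.ext ⟨A, W⟦(1:ℤ)⟧, _, _, _, subset_thickClosure X hA, ht.sh hW' 1,
      rot_of_distTriang _ hT⟩

section
variable {X : Set C}

theorem mem_shift_le (hc : cosuspended X) (hi : isoClosed X) (A : C) (a b : ℤ) (hab : b ≤ a)
    (h : A⟦a⟧ ∈ X) : A⟦b⟧ ∈ X := by
  induction b, hab using Int.leInductionDown with
  | base => exact h
  | pred n hn ih =>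
    exact hi (hc.1 ⟨_, ih, ⟨Iso.refl _⟩⟩) (shIso A n (-1) (n-1) (by omega))

theorem zero_mem (ha : isAdd X) {Z : C} (hZ : IsZero Z) : Z ∈ X := by
  obtain ⟨Z', h, h0⟩ := ha.2.1.1
  exact ha.1 h (h0.iso hZ)

theorem U_thick (hc : cosuspended X) (ha : isAdd X) : IsThick {Z : C | ∃ a : ℤ, Z⟦a⟧ ∈ X} where
  zero := by
    refine ⟨(HasZeroObject.zero' C).zero, ⟨0, zero_mem ha ?_⟩, isZero_zero C⟩
    exact Functor.map_isZero _ (isZero_zero C)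
  iso := by
    rintro A B ⟨a, h⟩ e
    exact ⟨a, ha.1 h ((shiftFunctor C a).mapIso e)⟩
  shift := by
    rintro n Z ⟨A, ⟨a, h⟩, ⟨e⟩⟩
    exact ⟨a - n, ha.1 h ((shiftFunctor C (a-n)).mapIso e ≪≫ shIso A n (a-n) a (by omega)).symm⟩
  ext := by
    rintro Z ⟨A, B, f, g, h, ⟨a, hA⟩, ⟨b, hB⟩, hT⟩
    refine ⟨min a b, hc.2 ⟨A⟦min a b⟧, B⟦min a b⟧, _, _, _, ?_, ?_,
      Triangle.shift_distinguished _ hT (min a b)⟩⟩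
    · exact mem_shift_le hc ha.1 A a _ (min_le_left _ _) hA
    · exact mem_shift_le hc ha.1 B b _ (min_le_right _ _) hB
  summand := by
    rintro W Z ⟨a, h⟩ ⟨i, r, hir⟩
    refine ⟨a, ha.2.2 h ⟨i⟦a⟧', r⟦a⟧', ?_⟩⟩
    rw [← Functor.map_comp, hir, CategoryTheory.Functor.map_id]

theorem U_subset_hat (hc : cosuspended X) (ha : isAdd X) :
    {Z : C | ∃ a : ℤ, Z⟦a⟧ ∈ X} ⊆ hat X := by
  have key : ∀ (n : ℕ) (Z : C), Z⟦(-n : ℤ)⟧ ∈ X → Z ∈ epsHat X n := by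
    intro n
    induction n with
    | zero =>
      intro Z hZ
      exact ha.1 hZ ((shiftFunctorZero' C (-((0:ℕ):ℤ)) (by simp)).app Z)
    | succ n ih =>
      intro Z hZ
      have h1 : Z⟦(-1:ℤ)⟧ ∈ epsHat X n :=
        ih _ (ha.1 hZ (shIso Z (-1) (-n) _ (by push_cast; omega)).symm)
      let e := (shIso Z (-1) 1 0 (by norm_num) ≪≫ (shiftFunctorZero C ℤ).app Z).symm
      obtain ⟨Y, f, g, hT⟩ := distinguished_cocone_triangle₂ e.hom
      have hY : IsZero Y := Triangle.isZero₂_of_isIso₃ _ hT (inferInstanceAs (IsIso e.hom))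
      exact ⟨_, Y, f, g, _, h1, zero_mem ha hY, hT⟩
  rintro Z ⟨a, h⟩
  refine Set.mem_iUnion.2 ⟨a.natAbs, key _ _ (mem_shift_le hc ha.1 Z a _ (by omega) h)⟩

theorem hat_eq (hc : cosuspended X) (ha : isAdd X) : hat X = thickClosure X := by
  apply Set.Subset.antisymm (hat_subset X)
  intro Z hZ
  apply U_subset_hat hc ha
  refine hZ _ ⟨U_thick hc ha, ?_⟩
  intro A hA
  exact ⟨0, ha.1 hA ((shiftFunctorZero C ℤ).app A).symm⟩

end

/-- Krull-Schmidt decompositions by number of summands. -/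
def KSn : ℕ → C → Prop
  | 0, Z => IsZero Z
  | n + 1, Z => ∃ A W : C, isDirectSum Z A W ∧ IsLocalRing (End A) ∧ KSn n W

theorem exists_KSn (ks : KrullSchmidt C) (Z : C) : ∃ n, KSn n Z := by
  obtain ⟨l, h1, h2⟩ := ks Z
  refine ⟨l.length, ?_⟩
  clear ks
  induction l generalizing Z with
  | nil => exact h1
  | cons A l ih =>
    obtain ⟨W, hW, hl⟩ := h1
    exact ⟨A, W, hW, (h2 A (by simp)).2, ih W hl (fun B hB => h2 B (by simp [hB]))⟩

theorem local_alt {S : Type*} [Ring S] [IsLocalRing S] (a : S) : IsUnit a ∨ IsUnit (1 - a) :=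
  IsLocalRing.isUnit_or_isUnit_of_add_one (add_sub_cancel a 1)

theorem elim_lemma (n : ℕ) (Z : C) (hZ : KSn n Z) (ψ : Z ⟶ Z) :
    (∃ χ : Z ⟶ Z, (𝟙 Z - ψ) ≫ χ = 𝟙 Z) ∨
    ∃ (m : ℕ) (B W : C) (b : B ⟶ Z) (p : Z ⟶ B) (j : W ⟶ Z) (q : Z ⟶ W) (i : B ⟶ Z)
      (s : B ⟶ B),
      m < n ∧ KSn m W ∧ p ≫ i + q ≫ j = 𝟙 Z ∧ i ≫ p = 𝟙 B ∧ j ≫ q = 𝟙 W ∧ j ≫ p = 0 ∧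
        i ≫ q = 0 ∧ s ≫ b ≫ ψ ≫ p = 𝟙 B ∧ (b ≫ ψ ≫ p) ≫ s = 𝟙 B := by
  induction n generalizing Z with
  | zero => exact Or.inl ⟨0, hZ.eq_of_src _ _⟩
  | succ n ih =>
    obtain ⟨A, W, ⟨iA, iW, pA, pW, h1, h2, h3, h4, h5⟩, hloc, hW⟩ := hZ
    have hu := local_alt (S := End A) (iA ≫ ψ ≫ pA)
    rcases hu with hu | hu
    · right
      obtain ⟨s, hs1, hs2⟩ := isUnit_iff_exists.1 hu
      exact ⟨n, A, W, iA, pA, iW, pW, iA, s, by omega, hW, h5, h1, h2, h4, h3, hs1, hs2⟩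
    · obtain ⟨t, ht1, ht2⟩ := isUnit_iff_exists.1 hu
      change A ⟶ A at t
      change t ≫ (𝟙 A - iA ≫ ψ ≫ pA) = 𝟙 A at ht1
      change (𝟙 A - iA ≫ ψ ≫ pA) ≫ t = 𝟙 A at ht2
      rcases ih W hW (iW ≫ ψ ≫ pW + (iW ≫ ψ ≫ pA) ≫ t ≫ (iA ≫ ψ ≫ pW)) with
        ⟨χ, hχ⟩ | ⟨m, B, V, b, p, j, q, i, s, hm, hV, g1, g2, g3, g4, g5, g6, g7⟩
      · left
        have hM1 : iA ≫ (𝟙 Z - ψ) ≫ pA = 𝟙 A - iA ≫ ψ ≫ pA := by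
          simp [Preadditive.sub_comp, Preadditive.comp_sub, h1]
        have hM2 : iA ≫ (𝟙 Z - ψ) ≫ pW = - (iA ≫ ψ ≫ pW) := by
          simp [Preadditive.sub_comp, Preadditive.comp_sub, h3]
        have hM3 : iW ≫ (𝟙 Z - ψ) ≫ pA = - (iW ≫ ψ ≫ pA) := by
          simp [Preadditive.sub_comp, Preadditive.comp_sub, h4]
        have hM4 : iW ≫ (𝟙 Z - ψ) ≫ pW = 𝟙 W - (iW ≫ ψ ≫ pW) := by
          simp [Preadditive.sub_comp, Preadditive.comp_sub, h2]
        generalize 𝟙 Z - ψ = M at *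
        generalize iA ≫ ψ ≫ pA = w at *
        generalize iA ≫ ψ ≫ pW = x at *
        generalize iW ≫ ψ ≫ pA = y at *
        generalize iW ≫ ψ ≫ pW = z at *
        refine ⟨pA ≫ t ≫ iA + (pA ≫ t ≫ x + pW) ≫ χ ≫ (iW + y ≫ t ≫ iA), ?_⟩
        have e1 : iA ≫ M ≫ (pA ≫ t ≫ iA + (pA ≫ t ≫ x + pW) ≫ χ ≫ (iW + y ≫ t ≫ iA)) = iA := by
          have : iA ≫ M ≫ (pA ≫ t ≫ iA + (pA ≫ t ≫ x + pW) ≫ χ ≫ (iW + y ≫ t ≫ iA))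
              = ((iA ≫ M ≫ pA) ≫ t) ≫ iA + (((iA ≫ M ≫ pA) ≫ t) ≫ x + iA ≫ M ≫ pW) ≫
                χ ≫ (iW + y ≫ t ≫ iA) := by
            simp only [Preadditive.comp_add, Preadditive.add_comp, Category.assoc]
          rw [this, hM1, hM2, ht2]
          simp
        have e2 : iW ≫ M ≫ (pA ≫ t ≫ iA + (pA ≫ t ≫ x + pW) ≫ χ ≫ (iW + y ≫ t ≫ iA)) = iW := by
          have : iW ≫ M ≫ (pA ≫ t ≫ iA + (pA ≫ t ≫ x + pW) ≫ χ ≫ (iW + y ≫ t ≫ iA))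
              = (iW ≫ M ≫ pA) ≫ t ≫ iA + (((iW ≫ M ≫ pA) ≫ t ≫ x + iW ≫ M ≫ pW) ≫
                χ) ≫ (iW + y ≫ t ≫ iA) := by
            simp only [Preadditive.comp_add, Preadditive.add_comp, Category.assoc]
          have h6 : (-y) ≫ t ≫ x + (𝟙 W - z) = 𝟙 W - (z + y ≫ t ≫ x) := by
            rw [Preadditive.neg_comp]; abel
          rw [this, hM3, hM4, h6, hχ]
          simp
        generalize pA ≫ t ≫ iA + (pA ≫ t ≫ x + pW) ≫ χ ≫ (iW + y ≫ t ≫ iA) = N at *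
        calc M ≫ N = (pA ≫ iA + pW ≫ iW) ≫ M ≫ N := by rw [h5, Category.id_comp]
          _ = 𝟙 Z := by
            rw [Preadditive.add_comp, Category.assoc, Category.assoc, e1, e2, h5]
      · right
        have key : (b ≫ iW + (b ≫ iW ≫ ψ ≫ pA) ≫ t ≫ iA) ≫ ψ ≫ pW ≫ p =
            b ≫ (iW ≫ ψ ≫ pW + (iW ≫ ψ ≫ pA) ≫ t ≫ (iA ≫ ψ ≫ pW)) ≫ p := by
          simp only [Preadditive.comp_add, Preadditive.add_comp, Category.assoc]
        refine ⟨m + 1, B, A ⊞ V, b ≫ iW + (b ≫ iW ≫ ψ ≫ pA) ≫ t ≫ iA, pW ≫ p,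
          biprod.desc iA (j ≫ iW), biprod.lift pA (pW ≫ q), i ≫ iW, s, by omega,
          ⟨A, V, ⟨biprod.inl, biprod.inr, biprod.fst, biprod.snd, by simp, by simp, by simp,
            by simp, by simp⟩, hloc, hV⟩, ?_, ?_, ?_, ?_, ?_, ?_, ?_⟩
        · have : pW ≫ iW = pW ≫ (p ≫ i + q ≫ j) ≫ iW := by rw [g1, Category.id_comp]
          rw [biprod.lift_desc, ← h5, this]
          simp only [Preadditive.comp_add, Preadditive.add_comp, Category.assoc]
          abel
        · simp [reassoc_of% h2, g2]
        · ext <;> simp [h1, h3, h4, reassoc_of% h2, reassoc_of% h3, g3]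
        · ext <;> simp [reassoc_of% h3, reassoc_of% h2, g4]
        · ext <;> simp [h4, reassoc_of% h2, g5]
        · rw [key]; exact g6
        · rw [key]; exact g7

theorem min_precover (ks : KrullSchmidt C) {X : Set C} (ha : isAdd X) (M : C)
    (h : ∃ (X' : C) (f : X' ⟶ M), X' ∈ X ∧
      ∀ (X'' : C), X'' ∈ X → ∀ g : X'' ⟶ M, ∃ h : X'' ⟶ X', h ≫ f = g) :
    ∃ (X' : C) (f : X' ⟶ M), X' ∈ X ∧
      (∀ (X'' : C), X'' ∈ X → ∀ g : X'' ⟶ M, ∃ h : X'' ⟶ X', h ≫ f = g) ∧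
      ∀ φ : X' ⟶ X', φ ≫ f = f → ∃ χ : X' ⟶ X', φ ≫ χ = 𝟙 X' := by
  obtain ⟨X', f, hX', hf⟩ := h
  obtain ⟨n, hn⟩ := exists_KSn ks X'
  induction n using Nat.strong_induction_on generalizing X' with
  | _ n ih =>
    by_cases hmin : ∀ φ : X' ⟶ X', φ ≫ f = f → ∃ χ : X' ⟶ X', φ ≫ χ = 𝟙 X'
    · exact ⟨X', f, hX', hf, hmin⟩
    · push Not at hmin
      obtain ⟨φ, hφ, hno⟩ := hmin
      rcases elim_lemma n X' hn (𝟙 X' - φ) with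
        ⟨χ, hχ⟩ | ⟨m, B, V, b, p, j, q, i, s, hm, hV, g1, g2, g3, g4, g5, g6, g7⟩
      · exact absurd (by simpa using hχ) (hno χ)
      · refine ih m hm V (j ≫ f) (ha.2.2 hX' ⟨j, q, g3⟩) ?_ hV
        intro X'' hX'' g
        obtain ⟨x, hx⟩ := hf X'' hX'' g
        let r := x - (x ≫ p) ≫ s ≫ b ≫ (𝟙 X' - φ)
        have hrp : r ≫ p = 0 := by
          simp only [r, Preadditive.sub_comp, Category.assoc] at g6 ⊢
          rw [g6]; simp
        have hrf : r ≫ f = g := by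
          simp [r, Preadditive.sub_comp, hφ, hx]
        refine ⟨r ≫ q, ?_⟩
        have : r = r ≫ q ≫ j := by
          calc r = r ≫ (p ≫ i + q ≫ j) := by rw [g1, Category.comp_id]
            _ = _ := by rw [Preadditive.comp_add, reassoc_of% hrp]; simp
        rw [← hrf]
        conv_rhs => rw [this]
        simp

/-- Wakamatsu's lemma. -/
theorem wakamatsu {X : Set C} (hc : cosuspended X) {X' M Z : C} (f : X' ⟶ M)
    (g : M ⟶ Z) (h : Z ⟶ X'⟦(1:ℤ)⟧) (hT : Triangle.mk f g h ∈ distTriang C)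
    (hX' : X' ∈ X)
    (hf : ∀ (X'' : C), X'' ∈ X → ∀ g : X'' ⟶ M, ∃ h : X'' ⟶ X', h ≫ f = g)
    (hmin : ∀ φ : X' ⟶ X', φ ≫ f = f → ∃ χ : X' ⟶ X', φ ≫ χ = 𝟙 X') :
    Z ∈ rightOrth X := by
  intro A hA a
  obtain ⟨E, i, p, hE⟩ := distinguished_cocone_triangle₂ (a ≫ h)
  have hEX : E ∈ X := hc.2 ⟨X', A, i, p, _, hX', hA, hE⟩
  obtain ⟨e, he1, he2⟩ := complete_distinguished_triangle_morphism₂ _ _ hE hT (𝟙 X') a (by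
    change (a ≫ h) ≫ (𝟙 X')⟦(1:ℤ)⟧' = a ≫ h
    simp)
  change E ⟶ M at e
  change i ≫ e = 𝟙 X' ≫ f at he1
  rw [Category.id_comp] at he1
  obtain ⟨r, hr⟩ := hf E hEX e
  obtain ⟨χ, hχ⟩ := hmin (i ≫ r) (by
    rw [Category.assoc, hr]
    exact he1)
  have hah : a ≫ h = 0 := by
    apply Triangle.mor₃_eq_zero_of_mono₁ _ hE
    have : i ≫ (r ≫ χ) = 𝟙 X' := by simpa using hχ
    exact (SplitMono.mk (r ≫ χ) this).mono
  obtain ⟨c, hc⟩ := exact₃ hT a hah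
  obtain ⟨d, hd⟩ := hf A hA c
  have h0 : f ≫ g = 0 := comp_distTriang_mor_zero₁₂ _ hT
  rw [← hc, ← hd, Category.assoc, h0, comp_zero]

theorem summand_of_zero₂ {A Z B : C} {f : A ⟶ Z} {g : Z ⟶ B} {h : B ⟶ A⟦(1:ℤ)⟧}
    (hT : Triangle.mk f g h ∈ distTriang C) (hg : g = 0) : ∃ (i : Z ⟶ A), i ≫ f = 𝟙 Z := by
  exact exact₂ hT (𝟙 Z) (by simpa using hg)

theorem summand_of_zero₁ {A Z B : C} {f : A ⟶ Z} {g : Z ⟶ B} {h : B ⟶ A⟦(1:ℤ)⟧}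
    (hT : Triangle.mk f g h ∈ distTriang C) (hf : f = 0) : ∃ (r : B ⟶ Z), g ≫ r = 𝟙 Z := by
  exact coexact₂ hT (𝟙 Z) (by simpa using hf)

theorem part1 (ks : KrullSchmidt C) (X : Set C) (hc : cosuspended X) (ha : isAdd X)
    (hp : precoveringIn X (hat X)) :
    IsCotStructure (thickClosure X) X (shf (rightOrth X) (-1) ∩ hat X) := by
  have ht := thickClosure_thick X
  have hh := hat_eq hc ha
  have hmem : ∀ Z : C, Z ∈ shf (rightOrth X) (-1) ↔ Z⟦(1:ℤ)⟧ ∈ rightOrth X :=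
    mem_shf_iff (rightOrth_iso X) (-1) 1 (by norm_num)
  have hshX : shf X (-1) ⊆ X := hc.1
  rw [hh] at hp ⊢
  refine ⟨subset_thickClosure X, fun _ h => h.2, ha.1, ?_, ha.2.1, ⟨?_, ?_⟩, ha.2.2, ?_, hc.1, ?_,
    ?_, ?_⟩
  · rintro A B ⟨h1, h2⟩ e
    refine ⟨?_, ht.iso h2 e⟩
    rw [hmem] at h1 ⊢
    exact rightOrth_iso X h1 ((shiftFunctor C (1:ℤ)).mapIso e)
  · obtain ⟨Z, hZ, h0⟩ := ht.zero
    refine ⟨Z, ⟨?_, hZ⟩, h0⟩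
    rw [hmem]
    intro A hA f
    exact (Functor.map_isZero (shiftFunctor C (1:ℤ)) h0).eq_of_tgt _ _
  · rintro A B W ⟨hA, hA'⟩ ⟨hB, hB'⟩ hW
    refine ⟨?_, ht.ext (star_of_directSum hW hA' hB')⟩
    rw [hmem] at hA hB ⊢
    obtain ⟨iA, iB, pA, pB, h1, h2, h3, h4, h5⟩ := hW
    intro D hD f
    have e : f = f ≫ (shiftFunctor C (1:ℤ)).map (pA ≫ iA + pB ≫ iB) := by rw [h5]; simp
    rw [e, Functor.map_add, Functor.map_comp, Functor.map_comp, Preadditive.comp_add,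
      ← Category.assoc, ← Category.assoc, hA D hD (f ≫ pA⟦(1:ℤ)⟧'), hB D hD (f ≫ pB⟦(1:ℤ)⟧')]
    simp
  · rintro W Z ⟨h1, h2⟩ ⟨i, r, hir⟩
    refine ⟨?_, ht.summand h2 ⟨i, r, hir⟩⟩
    rw [hmem] at h1 ⊢
    intro D hD f
    have e : f = (f ≫ i⟦(1:ℤ)⟧') ≫ r⟦(1:ℤ)⟧' := by
      rw [Category.assoc, ← Functor.map_comp, hir]; simp
    rw [e, h1 D hD (f ≫ i⟦(1:ℤ)⟧'), zero_comp]
  · rintro Z ⟨A, ⟨h1, h2⟩, ⟨e⟩⟩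
    refine ⟨?_, ht.shift 1 ⟨A, h2, ⟨e⟩⟩⟩
    rw [hmem] at h1 ⊢
    refine rightOrth_iso X (A := A⟦(1:ℤ)⟧⟦(1:ℤ)⟧) ?_ ((shiftFunctor C (1:ℤ)).mapIso e).symm
    intro D hD f
    exact hom_zero_up (h1 _ (hshX ⟨D, hD, ⟨Iso.refl _⟩⟩)) f
  · rintro A' ⟨A, hA, ⟨e⟩⟩ B ⟨hB, -⟩ f
    rw [hmem] at hB
    have := hom_zero_down (hB A hA) (e.inv ≫ f)
    rw [← cancel_epi e.inv, this, comp_zero]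
  · apply Set.Subset.antisymm
    · intro M hM
      have hM1 := ht.sh hM 1
      obtain ⟨X', f, hX', hf, hmin⟩ := min_precover ks ha _ (hp _ hM1)
      obtain ⟨Z, g, h, hT⟩ := distinguished_cocone_triangle f
      have hZ := wakamatsu hc f g h hT hX' hf hmin
      have hZt : Z ∈ thickClosure X :=
        ht.ext ⟨_, _, _, _, _, hM1, ht.sh (subset_thickClosure X hX') 1, rot_of_distTriang _ hT⟩
      refine star_iso _ _ (Z := M⟦(1:ℤ)⟧⟦(-1:ℤ)⟧) ?_
        (shIso M 1 (-1) 0 (by norm_num) ≪≫ (shiftFunctorZero C ℤ).app M)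
      exact ⟨X'⟦(-1:ℤ)⟧, Z⟦(-1:ℤ)⟧, _, _, _, ⟨X', hX', ⟨Iso.refl _⟩⟩,
        ⟨⟨Z, hZ, ⟨Iso.refl _⟩⟩, ht.sh hZt _⟩, Triangle.shift_distinguished _ hT (-1)⟩
    · rintro M ⟨A, B, f, g, h, hA, ⟨-, hB⟩, hT⟩
      exact ht.ext ⟨A, B, f, g, h, subset_thickClosure X (hshX hA), hB, hT⟩

theorem part2 (X Y : Set C) (H : IsCotStructure (thickClosure X) X Y) :
    (cosuspended X ∧ isAdd X ∧ precoveringIn X (hat X)) ∧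
        Y = shf (rightOrth X) (-1) ∩ hat X := by
  have ht := thickClosure_thick X
  have ha : isAdd X := ⟨H.isoA, H.addA, H.summandA⟩
  have hmem : ∀ Z : C, Z ∈ shf (rightOrth X) (-1) ↔ Z⟦(1:ℤ)⟧ ∈ rightOrth X :=
    mem_shf_iff (rightOrth_iso X) (-1) 1 (by norm_num)
  have hY : ∀ B ∈ Y, B⟦(1:ℤ)⟧ ∈ rightOrth X := by
    intro B hB A hA f
    exact hom_zero_up (H.orth _ ⟨A, hA, ⟨Iso.refl _⟩⟩ B hB) f
  -- every object of the thick closure sits in a triangle `A ⟶ M ⟶ B⟦1⟧`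
  have hdec : ∀ M ∈ thickClosure X, M ∈ star X (rightOrth X) := by
    intro M hM
    have h1 : M⟦(-1:ℤ)⟧ ∈ star (shf X (-1)) Y := H.decomp ▸ ht.sh hM (-1)
    refine star_iso _ _ (star_shift_s2 h1 1 ?_ hY)
      (shIso M (-1) 1 0 (by norm_num) ≪≫ (shiftFunctorZero C ℤ).app M)
    intro A hA
    exact (mem_shf_iff ha.1 (-1) 1 (by norm_num) A).1 hA
  have hc : cosuspended X := by
    refine ⟨H.shiftA, ?_⟩
    intro Z hZ
    have hZt : Z ∈ thickClosure X := by
      obtain ⟨A, B, f, g, h, hA, hB, hT⟩ := hZ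
      exact ht.ext ⟨A, B, f, g, h, H.subA hA, H.subA hB, hT⟩
    obtain ⟨A, B, f, g, h, hA, hB, hT⟩ := hdec Z hZt
    obtain ⟨A', B', f', g', h', hA', hB', hT'⟩ := hZ
    have hg : g = 0 := by
      obtain ⟨k, hk⟩ := coexact₂ hT' g (hB _ hA' _)
      rw [← hk, hB _ hB' k, comp_zero]
    obtain ⟨i, hi⟩ := summand_of_zero₂ hT hg
    exact H.summandA hA ⟨i, f, hi⟩
  have hh := hat_eq hc ha
  refine ⟨⟨hc, ha, ?_⟩, ?_⟩
  · rw [hh]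
    intro M hM
    obtain ⟨A, B, f, g, h, hA, hB, hT⟩ := hdec M hM
    refine ⟨A, f, hA, ?_⟩
    intro X'' hX'' k
    exact exact₂ hT k (hB _ hX'' _)
  · rw [hh]
    apply Set.Subset.antisymm
    · intro B hB
      exact ⟨(hmem B).2 (hY B hB), H.subB hB⟩
    · rintro Z ⟨h1, h2⟩
      rw [hmem] at h1
      rw [H.decomp] at h2
      obtain ⟨A, B, f, g, h, ⟨D, hD, ⟨e⟩⟩, hB, hT⟩ := h2
      have hf : f = 0 := by
        have := hom_zero_down (h1 D hD) (e.inv ≫ f)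
        rw [← cancel_epi e.inv, this, comp_zero]
      obtain ⟨r, hr⟩ := summand_of_zero₁ hT hf
      exact H.summandB hB ⟨g, r, hr⟩

/-- For `R` a commutative artinian ring and `T` an `R`-linear, Hom-finite,
Krull-Schmidt triangulated category, the assignment `X ↦ (X, X^⊥[-1] ∩ X^∧)` is a bijection
between (i) cosuspended subcategories `X = add X` of `T` which are precovering in `X^∧`,
and (ii) pairs `(X, Y)` which are co-t-structures on `Δ̄_T(X)`; the inverse sends
`(X, Y)` to `X`. -/
theorem stmt2 (R : Type*) [CommRing R] [IsArtinianRing R] [CategoryTheory.Linear R C]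
    (homFinite : ∀ A B : C, Module.Finite R (A ⟶ B))
    (ks : KrullSchmidt C) :
    (∀ X : Set C, cosuspended X → isAdd X → precoveringIn X (hat X) →
      IsCotStructure (thickClosure X) X (shf (rightOrth X) (-1) ∩ hat X)) ∧
    ∀ X Y : Set C, IsCotStructure (thickClosure X) X Y →
      (cosuspended X ∧ isAdd X ∧ precoveringIn X (hat X)) ∧
        Y = shf (rightOrth X) (-1) ∩ hat X := by
  exact ⟨fun X hc ha hp => part1 ks X hc ha hp, fun X Y H => part2 X Y H⟩

end CotPaper
end

section
/- Let (X, ω) be a pair of classes of objects in a triangulated category T, both closed under direct summands, with X cosuspended and ω an X-injective weak-cogenerator in X. Then ω^∧ = X^∧ ∩ X^⊥[-1], X = X^∧ ∩ (⊥(ω^∧))[1], and ω = X ∩ X^⊥[-1]. -/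
open CategoryTheory CategoryTheory.Limits CategoryTheory.Pretriangulated

universe v u

variable (C : Type u) [Category.{v} C] [HasZeroObject C] [HasShift C ℤ]
  [Preadditive C] [∀ n : ℤ, (CategoryTheory.shiftFunctor C n).Additive]
  [Pretriangulated C]

namespace CotPaper

variable {C}

section helpers

set_option linter.unusedSectionVars false

lemma tr3 {A B D A' B' D' : C} {f : A ⟶ B} {g : B ⟶ D} {h : D ⟶ A⟦(1:ℤ)⟧}
    {f' : A' ⟶ B'} {g' : B' ⟶ D'} {h' : D' ⟶ A'⟦(1:ℤ)⟧}
    (hT : Triangle.mk f g h ∈ distTriang C) (hT' : Triangle.mk f' g' h' ∈ distTriang C)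
    (a : A ⟶ A') (b : B ⟶ B') (hab : f ≫ b = a ≫ f') :
    ∃ c : D ⟶ D', g ≫ c = b ≫ g' ∧ h ≫ a⟦(1:ℤ)⟧' = c ≫ h' :=
  complete_distinguished_triangle_morphism _ _ hT hT' a b hab

lemma tr3b {A B D A' B' D' : C} {f : A ⟶ B} {g : B ⟶ D} {h : D ⟶ A⟦(1:ℤ)⟧}
    {f' : A' ⟶ B'} {g' : B' ⟶ D'} {h' : D' ⟶ A'⟦(1:ℤ)⟧}
    (hT : Triangle.mk f g h ∈ distTriang C) (hT' : Triangle.mk f' g' h' ∈ distTriang C)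
    (a : A ⟶ A') (c : D ⟶ D') (hac : h ≫ a⟦(1:ℤ)⟧' = c ≫ h') :
    ∃ b : B ⟶ B', f ≫ b = a ≫ f' ∧ g ≫ c = b ≫ g' :=
  complete_distinguished_triangle_morphism₂ _ _ hT hT' a c hac

lemma ex2 {A B D : C} {f : A ⟶ B} {g : B ⟶ D} {h : D ⟶ A⟦(1:ℤ)⟧}
    (hT : Triangle.mk f g h ∈ distTriang C) {T : C} (u : T ⟶ B) (hu : u ≫ g = 0) :
    ∃ x : T ⟶ A, x ≫ f = u := by
  obtain ⟨x, hx⟩ := Triangle.coyoneda_exact₂ _ hT u hu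
  exact ⟨x, hx.symm⟩

lemma ex3 {A B D : C} {f : A ⟶ B} {g : B ⟶ D} {h : D ⟶ A⟦(1:ℤ)⟧}
    (hT : Triangle.mk f g h ∈ distTriang C) {T : C} (u : T ⟶ D) (hu : u ≫ h = 0) :
    ∃ x : T ⟶ B, x ≫ g = u := by
  obtain ⟨x, hx⟩ := Triangle.coyoneda_exact₃ _ hT u hu
  exact ⟨x, hx.symm⟩

lemma ex1 {A B D : C} {f : A ⟶ B} {g : B ⟶ D} {h : D ⟶ A⟦(1:ℤ)⟧}
    (hT : Triangle.mk f g h ∈ distTriang C) {T : C} (u : T ⟶ A⟦(1:ℤ)⟧)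
    (hu : u ≫ f⟦(1:ℤ)⟧' = 0) :
    ∃ x : T ⟶ D, x ≫ h = u := by
  obtain ⟨x, hx⟩ := Triangle.coyoneda_exact₁ _ hT u hu
  exact ⟨x, hx.symm⟩

lemma ey2 {A B D : C} {f : A ⟶ B} {g : B ⟶ D} {h : D ⟶ A⟦(1:ℤ)⟧}
    (hT : Triangle.mk f g h ∈ distTriang C) {T : C} (u : B ⟶ T) (hu : f ≫ u = 0) :
    ∃ x : D ⟶ T, g ≫ x = u := by
  obtain ⟨x, hx⟩ := Triangle.yoneda_exact₂ _ hT u hu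
  exact ⟨x, hx.symm⟩

lemma ey3 {A B D : C} {f : A ⟶ B} {g : B ⟶ D} {h : D ⟶ A⟦(1:ℤ)⟧}
    (hT : Triangle.mk f g h ∈ distTriang C) {T : C} (u : D ⟶ T) (hu : g ≫ u = 0) :
    ∃ x : A⟦(1:ℤ)⟧ ⟶ T, h ≫ x = u := by
  obtain ⟨x, hx⟩ := Triangle.yoneda_exact₃ _ hT u hu
  exact ⟨x, hx.symm⟩

lemma rotT {A B D : C} {f : A ⟶ B} {g : B ⟶ D} {h : D ⟶ A⟦(1:ℤ)⟧}
    (hT : Triangle.mk f g h ∈ distTriang C) :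
    Triangle.mk g h (-(f⟦(1:ℤ)⟧')) ∈ distTriang C :=
  rot_of_distTriang _ hT

/-- maps out of the first object extend when the obstruction vanishes -/
lemma ey1 {A B D : C} {f : A ⟶ B} {g : B ⟶ D} {h : D ⟶ A⟦(1:ℤ)⟧}
    (hT : Triangle.mk f g h ∈ distTriang C) {T : C} (u : A ⟶ T)
    (hu : h ≫ u⟦(1:ℤ)⟧' = 0) :
    ∃ x : B ⟶ T, f ≫ x = u := by
  obtain ⟨x, hx⟩ := ey3 (rotT hT) (u⟦(1:ℤ)⟧') hu
  refine ⟨-(shiftFunctor C (1:ℤ)).preimage x, ?_⟩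
  apply (shiftFunctor C (1:ℤ)).map_injective
  rw [← hx]
  simp

lemma z12 {A B D : C} {f : A ⟶ B} {g : B ⟶ D} {h : D ⟶ A⟦(1:ℤ)⟧}
    (hT : Triangle.mk f g h ∈ distTriang C) : f ≫ g = 0 :=
  comp_distTriang_mor_zero₁₂ _ hT

lemma z23 {A B D : C} {f : A ⟶ B} {g : B ⟶ D} {h : D ⟶ A⟦(1:ℤ)⟧}
    (hT : Triangle.mk f g h ∈ distTriang C) : g ≫ h = 0 :=
  comp_distTriang_mor_zero₂₃ _ hT

lemma z31 {A B D : C} {f : A ⟶ B} {g : B ⟶ D} {h : D ⟶ A⟦(1:ℤ)⟧}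
    (hT : Triangle.mk f g h ∈ distTriang C) : h ≫ f⟦(1:ℤ)⟧' = 0 :=
  comp_distTriang_mor_zero₃₁ _ hT

/-- `Hom(T[-1], V) = 0` iff `Hom(T, V[1]) = 0`. -/
lemma hom_shift (T V : C) :
    (∀ f : T⟦(-1:ℤ)⟧ ⟶ V, f = 0) ↔ ∀ f : T ⟶ V⟦(1:ℤ)⟧, f = 0 := by
  constructor
  · intro H f
    have h1 : (shiftNegShift T (1:ℤ)).hom ≫ f = 0 := by
      rw [← (shiftFunctor C (1:ℤ)).map_preimage ((shiftNegShift T (1:ℤ)).hom ≫ f),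
        H ((shiftFunctor C (1:ℤ)).preimage _), Functor.map_zero]
    rw [← cancel_epi (shiftNegShift T (1:ℤ)).hom, h1, comp_zero]
  · intro H f
    apply (shiftFunctor C (1:ℤ)).map_injective
    rw [Functor.map_zero, ← cancel_epi (shiftNegShift T (1:ℤ)).inv, comp_zero]
    exact H _

lemma iso_mem {X : Set C} (hX : summandClosed X) {A B : C} (hA : A ∈ X) (e : A ≅ B) : B ∈ X :=
  hX hA ⟨e.inv, e.hom, by simp⟩

lemma mem_rightOrth_shift (X : Set C) (Z : C) :
    Z ∈ shf (rightOrth X) (-1) ↔ ∀ T ∈ X, ∀ f : T ⟶ Z⟦(1:ℤ)⟧, f = 0 := by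
  constructor
  · rintro ⟨A, hA, ⟨e⟩⟩ T hT f
    have h := hA T hT (f ≫ e.hom⟦(1:ℤ)⟧' ≫ (shiftNegShift A (1:ℤ)).hom)
    rw [← cancel_mono (e.hom⟦(1:ℤ)⟧' ≫ (shiftNegShift A (1:ℤ)).hom), h, zero_comp]
  · intro H
    exact ⟨Z⟦(1:ℤ)⟧, H, ⟨(shiftShiftNeg Z (1:ℤ)).symm⟩⟩

lemma mem_leftOrth_shift (Y : Set C) (Z : C) :
    Z ∈ shf (leftOrth Y) 1 ↔ ∀ B ∈ Y, ∀ f : Z ⟶ B⟦(1:ℤ)⟧, f = 0 := by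
  constructor
  · rintro ⟨A, hA, ⟨e⟩⟩ B hB f
    rw [← cancel_epi e.inv, comp_zero,
      ← (shiftFunctor C (1:ℤ)).map_preimage (e.inv ≫ f),
      hA B hB ((shiftFunctor C (1:ℤ)).preimage _), Functor.map_zero]
  · intro H
    exact ⟨Z⟦(-1:ℤ)⟧, fun B hB => (hom_shift Z B).2 (H B hB),
      ⟨(shiftNegShift Z (1:ℤ)).symm⟩⟩

lemma inj_vanish {X ω : Set C} (hinj : xInjective X ω) {W : C} (hW : W ∈ ω) :
    ∀ T ∈ X, ∀ f : T ⟶ W⟦(1:ℤ)⟧, f = 0 := by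
  have h := hinj W hW
  unfold idDim at h
  have hne : {n : ℕ∞ | ∃ m : ℕ, n = (m : ℕ∞) ∧
    ∀ i : ℤ, (m : ℤ) < i → ∀ A ∈ X, ∀ f : A ⟶ W⟦i⟧, f = 0}.Nonempty := by
    by_contra hn
    rw [Set.not_nonempty_iff_eq_empty] at hn
    rw [hn] at h
    simp at h
  have hm := csInf_mem hne
  rw [h] at hm
  obtain ⟨m, hm0, hm⟩ := hm
  have : m = 0 := by exact_mod_cast hm0.symm
  subst this
  exact hm 1 (by norm_num)

/-- Key lemma, avoiding the octahedral axiom. -/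
lemma key {Y' X' K W' X'' A Z : C}
    {y : Y' ⟶ X'} {x : X' ⟶ K} {d : K ⟶ Y'⟦(1:ℤ)⟧}
    (hT1 : Triangle.mk y x d ∈ distTriang C)
    {j : X' ⟶ W'} {l : W' ⟶ X''} {m : X'' ⟶ X'⟦(1:ℤ)⟧}
    (hT2 : Triangle.mk j l m ∈ distTriang C)
    {i : K ⟶ A} {q : A ⟶ Z} {δ : Z ⟶ K⟦(1:ℤ)⟧}
    (hT3 : Triangle.mk i q δ ∈ distTriang C)
    (hA : ∀ f : A ⟶ Y'⟦(1:ℤ)⟧, f = 0) (hW : ∀ f : W' ⟶ Y'⟦(1:ℤ)⟧, f = 0)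
    (hX : ∀ f : X'' ⟶ Y'⟦(1:ℤ)⟧, f = 0) :
    ∃ (H U V : C) (w : W' ⟶ H) (d' : H ⟶ Y'⟦(1:ℤ)⟧) (v : H ⟶ U) (p : U ⟶ Z)
      (z : Z ⟶ H⟦(1:ℤ)⟧) (a : A ⟶ V) (π : V ⟶ X'') (b : X'' ⟶ A⟦(1:ℤ)⟧)
      (g : U ⟶ V) (h : V ⟶ U) (s : U ⟶ W') (t : W' ⟶ U),
      Triangle.mk (y ≫ j) w d' ∈ distTriang C ∧ Triangle.mk v p z ∈ distTriang C ∧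
      Triangle.mk a π b ∈ distTriang C ∧ g ≫ h + s ≫ t = 𝟙 U := by
  obtain ⟨H, w, d', hH⟩ := distinguished_cocone_triangle (y ≫ j)
  obtain ⟨f, hf1, hf2⟩ := tr3 hT1 hH (𝟙 Y') j (by simp)
  have hf1 : x ≫ f = j ≫ w := hf1
  have hf2 : d = f ≫ d' := by simpa using hf2
  obtain ⟨U, v, p, hU⟩ := distinguished_cocone_triangle₂ (δ ≫ f⟦(1:ℤ)⟧')
  obtain ⟨a', ha1, ha2⟩ := tr3b hT3 hU f (𝟙 Z)
    (by simp)
  have ha1 : i ≫ a' = f ≫ v := ha1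
  have ha2 : q = a' ≫ p := by simpa using ha2
  obtain ⟨V, a, π, hV⟩ := distinguished_cocone_triangle₂ ((m ≫ x⟦(1:ℤ)⟧') ≫ (-(i⟦(1:ℤ)⟧')))
  obtain ⟨e, he1, he2⟩ := tr3b hV (rotT hT3) (𝟙 A)
    (m ≫ x⟦(1:ℤ)⟧') (by simp)
  have he1 : a ≫ e = q := by simpa using he1
  have he2 : π ≫ m ≫ x⟦(1:ℤ)⟧' = e ≫ δ := he2
  -- extension of maps to `Y'`
  have extX : ∀ u : X' ⟶ Y', ∃ n : W' ⟶ Y', j ≫ n = u := fun u => ey1 hT2 u (hX _)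
  have extK : ∀ u : K ⟶ Y', ∃ n : H ⟶ Y', f ≫ n = u := by
    intro u
    obtain ⟨n, hn⟩ := extX (x ≫ u)
    obtain ⟨n', hn'⟩ := ey2 hH n (by
      rw [Category.assoc, hn, ← Category.assoc, z12 hT1, zero_comp])
    obtain ⟨r, hr⟩ := ey3 hT1 (u - f ≫ n') (by
      rw [Preadditive.comp_sub, ← Category.assoc, hf1, Category.assoc, hn', hn, sub_self])
    refine ⟨n' + d' ≫ r, ?_⟩
    rw [Preadditive.comp_add, ← Category.assoc f d' r, ← hf2, hr]
    abel
  have vanH : ∀ u : H ⟶ Y'⟦(1:ℤ)⟧, f ≫ u = 0 → u = 0 := by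
    intro u hu
    obtain ⟨r, rfl⟩ := ey3 hH u (hW _)
    obtain ⟨r', hr'⟩ := ey2 (rotT (rotT hT1)) r (by
      rw [← Category.assoc, ← hf2] at hu
      exact hu)
    obtain ⟨n, hn⟩ := extX ((shiftFunctor C (1:ℤ)).preimage r')
    have hn2 : r' = j⟦(1:ℤ)⟧' ≫ n⟦(1:ℤ)⟧' := by
      rw [← Functor.map_comp, hn, Functor.map_preimage]
    rw [← hr', hn2]
    have := z31 hH
    rw [Functor.map_comp] at this
    rw [Preadditive.neg_comp, Preadditive.comp_neg, ← Category.assoc, ← Category.assoc, Category.assoc d', this,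
      zero_comp, neg_zero]
  have vanU : ∀ u : U ⟶ Y'⟦(1:ℤ)⟧, u = 0 := by
    intro u
    have h1 : v ≫ u = 0 := vanH _ (by
      rw [← Category.assoc, ← ha1, Category.assoc, hA (a' ≫ u), comp_zero])
    obtain ⟨b', rfl⟩ := ey2 hU u h1
    obtain ⟨c, rfl⟩ := ey3 hT3 b' (hA _)
    obtain ⟨n, hn⟩ := extK ((shiftFunctor C (1:ℤ)).preimage c)
    have hn2 : c = f⟦(1:ℤ)⟧' ≫ n⟦(1:ℤ)⟧' := by
      rw [← Functor.map_comp, hn, Functor.map_preimage]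
    have h2 := z23 hU
    rw [hn2, ← Category.assoc δ, ← Category.assoc p, h2, zero_comp]
  -- lifting through `κ`
  have liftM : ∀ (T : C) (u : T ⟶ K), u ≫ f = 0 → ∃ u' : T ⟶ X', u' ≫ x = u ∧ u' ≫ j = 0 := by
    intro T u hu
    obtain ⟨u0, hu0⟩ := ex3 hT1 u (by rw [hf2, ← Category.assoc, hu, zero_comp])
    obtain ⟨r, hr⟩ := ex2 hH (u0 ≫ j) (by
      rw [Category.assoc, ← hf1, ← Category.assoc, hu0, hu])
    refine ⟨u0 - r ≫ y, ?_, ?_⟩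
    · rw [Preadditive.sub_comp, Category.assoc, z12 hT1, comp_zero, sub_zero, hu0]
    · rw [Preadditive.sub_comp, Category.assoc, hr, sub_self]
  have hc : ∃ c : U ⟶ X'', c ≫ m ≫ x⟦(1:ℤ)⟧' = p ≫ δ := by
    let ι := shiftNegShift U (1:ℤ)
    obtain ⟨u, hu⟩ := (shiftFunctor C (1:ℤ)).map_surjective (ι.hom ≫ p ≫ δ)
    obtain ⟨u', hu1, hu2⟩ := liftM _ u (by
      apply (shiftFunctor C (1:ℤ)).map_injective
      rw [Functor.map_comp, hu, Functor.map_zero, Category.assoc, Category.assoc, z23 hU,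
        comp_zero])
    obtain ⟨c, hc⟩ := ex1 hT2 (ι.inv ≫ u'⟦(1:ℤ)⟧') (by
      rw [Category.assoc, ← Functor.map_comp, hu2, Functor.map_zero, comp_zero])
    refine ⟨c, ?_⟩
    rw [← Category.assoc, hc, Category.assoc, ← Functor.map_comp, hu1, hu, Iso.inv_hom_id_assoc]
  obtain ⟨c, hc⟩ := hc
  have hg : ∃ g : U ⟶ V, g ≫ e = p := by
    obtain ⟨g0, hg0⟩ := ex3 hV c (by
      rw [← Category.assoc, hc, Category.assoc, Preadditive.comp_neg, z31 hT3, neg_zero, comp_zero])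
    obtain ⟨t, ht⟩ := ex3 hT3 (p - g0 ≫ e) (by
      rw [Preadditive.sub_comp, Category.assoc, ← he2, ← Category.assoc g0, hg0, hc, sub_self])
    refine ⟨g0 + t ≫ a, ?_⟩
    rw [Preadditive.add_comp, Category.assoc, he1, ht]
    abel
  obtain ⟨g, hg⟩ := hg
  obtain ⟨h, hh⟩ := ex3 hU e (by
    rw [← Category.assoc, ← he2, Category.assoc, Category.assoc, ← Functor.map_comp, hf1,
      Functor.map_comp, ← Category.assoc m, z31 hT2, zero_comp, comp_zero])
  obtain ⟨s0, hs0⟩ := ex2 hU (𝟙 U - g ≫ h) (by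
    rw [Preadditive.sub_comp, Category.assoc, hh, hg, Category.id_comp, sub_self])
  obtain ⟨s, hs⟩ := ex3 hH s0 (vanU _)
  refine ⟨H, U, V, w, d', v, p, _, a, π, _, g, h, s, w ≫ v, hH, hU, hV, ?_⟩
  rw [← Category.assoc, hs, hs0]
  abel

lemma hat_vanish {X ω : Set C} (hX : cosuspended X) (hinj : xInjective X ω) :
    ∀ (n : ℕ) (Y : C), Y ∈ epsHat ω n → ∀ T ∈ X, ∀ f : T ⟶ Y⟦(1:ℤ)⟧, f = 0 := by
  intro n
  induction n with
  | zero => exact fun Y hY => inj_vanish hinj hY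
  | succ n ih =>
    rintro Y ⟨W, A, f, g, h, hW, hA, hT⟩ T hTX u
    have hT' := rotT (rotT (rotT hT))
    obtain ⟨x, hx⟩ := ex2 (rotT hT') u (by
      have := (hom_shift T (W⟦(1:ℤ)⟧)).1 (ih W hW _ (hX.1 ⟨T, hTX, ⟨Iso.refl _⟩⟩))
      exact this _)
    rw [← hx, inj_vanish hinj hA T hTX x, zero_comp]

lemma epsHat_mono {X ω : Set C} (h : ω ⊆ X) (n : ℕ) : epsHat ω n ⊆ epsHat X n := by
  induction n with
  | zero => exact h
  | succ n ih =>
    rintro Y ⟨W, A, f, g, k, hW, hA, hT⟩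
    exact ⟨W, A, f, g, k, ih hW, h hA, hT⟩

lemma cog_tri {X ω : Set C} (hXsum : summandClosed X) (hcog : weakCogenerator ω X)
    {Z : C} (hZ : Z ∈ X) :
    ∃ (W D : C) (j : Z ⟶ W) (l : W ⟶ D) (m : D ⟶ Z⟦(1:ℤ)⟧), W ∈ ω ∧ D ∈ X ∧
      Triangle.mk j l m ∈ distTriang C := by
  obtain ⟨D, W, f, g, h, ⟨A, hA, ⟨e⟩⟩, hW, hT⟩ := hcog.2 hZ
  exact ⟨W, _, _, _, _, hW,
    iso_mem hXsum hA ((shiftFunctor C (1:ℤ)).mapIso e ≪≫ shiftNegShift A (1:ℤ)).symm, rotT hT⟩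

open scoped ZeroObject in
lemma approx {X ω : Set C} (hXsum : summandClosed X) (hωsum : summandClosed ω)
    (hX : cosuspended X) (hinj : xInjective X ω) (hcog : weakCogenerator ω X) :
    ∀ (n : ℕ) (Z : C), Z ∈ epsHat X n →
      ∃ (k : ℕ) (Y A : C) (y : Y ⟶ A) (x : A ⟶ Z) (d : Z ⟶ Y⟦(1:ℤ)⟧),
        Y ∈ epsHat ω k ∧ A ∈ X ∧ Triangle.mk y x d ∈ distTriang C := by
  intro n
  induction n with
  | zero =>
    intro Z hZ
    obtain ⟨W, D, j, l, m, hW, -, -⟩ := cog_tri hXsum hcog hZ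
    have h0 : (0 : C) ∈ ω := hωsum hW ⟨0, 0, (isZero_zero C).eq_of_src _ _⟩
    exact ⟨0, 0, Z, _, _, _, h0, hZ, contractible_distinguished₁ Z⟩
  | succ n ih =>
    rintro Z ⟨K, A, i, q, δ, hK, hA, hT3⟩
    obtain ⟨k, Y', X', y, x, d, hY', hX', hT1⟩ := ih K hK
    obtain ⟨W', X'', j, l, m, hW', hX'', hT2⟩ := cog_tri hXsum hcog hX'
    have hv := hat_vanish hX hinj k Y' hY'
    obtain ⟨H, U, V, w, d', v, p, z, a, π, b, g, h, s, t, hH, hU, hV, hst⟩ :=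
      key hT1 hT2 hT3 (hv A hA) (hv W' (hcog.1 hW')) (hv X'' hX'')
    have hVX : V ∈ X := hX.2 ⟨A, X'', a, π, b, hA, hX'', hV⟩
    have hsum : (V ⊞ W') ∈ X := hX.2 ⟨V, W', _, _, _, hVX, hcog.1 hW',
      binaryBiproductTriangle_distinguished V W'⟩
    have hUX : U ∈ X := hXsum hsum ⟨biprod.lift g s, biprod.desc h t, by simpa using hst⟩
    exact ⟨k + 1, H, U, v, p, z, ⟨Y', W', _, w, d', hY', hW', hH⟩, hUX, hU⟩

end helpers

/-- If `X` and `ω` are classes closed under direct summands, `X` is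
cosuspended and `ω` is an `X`-injective weak-cogenerator in `X`, then
`ω^∧ = X^∧ ∩ X^⊥[-1]`, `X = X^∧ ∩ (⊥(ω^∧))[1]` and `ω = X ∩ X^⊥[-1]`. -/
theorem stmt4 (X ω : Set C) (hXsum : summandClosed X) (hωsum : summandClosed ω)
    (hX : cosuspended X) (hinj : xInjective X ω) (hcog : weakCogenerator ω X) :
    hat ω = hat X ∩ shf (rightOrth X) (-1) ∧
    X = hat X ∩ shf (leftOrth (hat ω)) 1 ∧
    ω = X ∩ shf (rightOrth X) (-1) := by
  have c3 : X ∩ shf (rightOrth X) (-1) ⊆ ω := by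
    rintro Z ⟨hZ, hZ'⟩
    rw [mem_rightOrth_shift] at hZ'
    obtain ⟨W, D, j, l, m, hW, hD, hT⟩ := cog_tri hXsum hcog hZ
    obtain ⟨r, hr⟩ := ey1 hT (𝟙 Z) (hZ' D hD _)
    exact hωsum hW ⟨j, r, hr⟩
  refine ⟨?_, ?_, ?_⟩
  · apply Set.Subset.antisymm
    · intro Z hZ
      obtain ⟨n, hn⟩ := Set.mem_iUnion.1 hZ
      exact ⟨Set.mem_iUnion.2 ⟨n, epsHat_mono hcog.1 n hn⟩,
        (mem_rightOrth_shift X Z).2 (hat_vanish hX hinj n Z hn)⟩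
    · rintro Z ⟨hZ, hZ'⟩
      rw [mem_rightOrth_shift] at hZ'
      obtain ⟨n, hn⟩ := Set.mem_iUnion.1 hZ
      obtain ⟨k, Y, A, y, x, d, hY, hA, hT⟩ := approx hXsum hωsum hX hinj hcog n Z hn
      have hAω : A ∈ ω := by
        refine c3 ⟨hA, (mem_rightOrth_shift X A).2 ?_⟩
        intro T hTX f
        obtain ⟨f', hf'⟩ := ex2 (rotT (rotT (rotT hT))) f (by
          rw [Preadditive.comp_neg, neg_eq_zero]
          exact hZ' T hTX _)
        rw [← hf', hat_vanish hX hinj k Y hY T hTX f', zero_comp]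
      exact Set.mem_iUnion.2 ⟨k + 1, Y, A, y, x, d, hY, hAω, hT⟩
  · apply Set.Subset.antisymm
    · intro Z hZ
      refine ⟨Set.mem_iUnion.2 ⟨0, hZ⟩, (mem_leftOrth_shift _ Z).2 ?_⟩
      intro B hB
      obtain ⟨n, hn⟩ := Set.mem_iUnion.1 hB
      exact hat_vanish hX hinj n B hn Z hZ
    · rintro Z ⟨hZ, hZ'⟩
      rw [mem_leftOrth_shift] at hZ'
      obtain ⟨n, hn⟩ := Set.mem_iUnion.1 hZ
      obtain ⟨k, Y, A, y, x, d, hY, hA, hT⟩ := approx hXsum hωsum hX hinj hcog n Z hn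
      obtain ⟨r, hr⟩ := ex3 hT (𝟙 Z) (hZ' Y (Set.mem_iUnion.2 ⟨k, hY⟩) _)
      exact hXsum hA ⟨r, x, hr⟩
  · apply Set.Subset.antisymm
    · intro W hW
      exact ⟨hcog.1 hW, (mem_rightOrth_shift X W).2 (inj_vanish hinj hW)⟩
    · exact c3

end CotPaper
end

section
/- Let (A, B) be a co-t-structure on a triangulated category T and ω := A ∩ B. Then Δ̄_T(ω) = ω~ = {C ∈ A^∧ : id_A(C) < ∞} = {C ∈ B^∨ : pd_B(C) < ∞} = A^∧ ∩ B^∨. -/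
open CategoryTheory CategoryTheory.Limits CategoryTheory.Pretriangulated

universe v u

variable (C : Type u) [Category.{v} C] [HasZeroObject C] [HasShift C ℤ]
  [Preadditive C] [∀ n : ℤ, (CategoryTheory.shiftFunctor C n).Additive]
  [Pretriangulated C]

namespace CotPaper

variable {C}

open scoped ZeroObject

set_option linter.unusedSectionVars false

/-- all maps from `X` to `Y` vanish -/
def HZ (X Y : C) : Prop := ∀ f : X ⟶ Y, f = 0

lemma HZ.iso {X Y X' Y' : C} (h : HZ X Y) (e : X ≅ X') (e' : Y ≅ Y') : HZ X' Y' := by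
  intro f
  have h1 := h (e.hom ≫ f ≫ e'.inv)
  have h2 : f = e.inv ≫ (e.hom ≫ f ≫ e'.inv) ≫ e'.hom := by simp
  rw [h2, h1]; simp

lemma HZ.shift {X Y : C} (h : HZ X Y) (n : ℤ) : HZ (X⟦n⟧) (Y⟦n⟧) := by
  intro f
  obtain ⟨g, rfl⟩ := (shiftFunctor C n).map_surjective f
  rw [h g]; simp

lemma HZ.mid_left {X Y Z W : C} {f : X ⟶ Y} {g : Y ⟶ Z} {t : Z ⟶ X⟦(1:ℤ)⟧}
    (hT : Triangle.mk f g t ∈ distTriang C) (h1 : HZ X W) (h3 : HZ Z W) : HZ Y W := by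
  intro k
  obtain ⟨l, hl⟩ := Triangle.yoneda_exact₂ _ hT k (h1 _)
  rw [hl, h3 l]; exact comp_zero

lemma HZ.mid_right {X Y Z W : C} {f : X ⟶ Y} {g : Y ⟶ Z} {t : Z ⟶ X⟦(1:ℤ)⟧}
    (hT : Triangle.mk f g t ∈ distTriang C) (h1 : HZ W X) (h3 : HZ W Z) : HZ W Y := by
  intro k
  obtain ⟨l, hl⟩ := Triangle.coyoneda_exact₂ _ hT k (h3 _)
  rw [hl, h1 l]; exact zero_comp

/-- `PA B k Z`: `Hom(Z, B[k]) = 0` -/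
def PA (B : Set C) (k : ℤ) (Z : C) : Prop := ∀ b ∈ B, HZ Z (b⟦k⟧)
/-- `PB A k Z`: `Hom(A, Z[k]) = 0` -/
def PB (A : Set C) (k : ℤ) (Z : C) : Prop := ∀ a ∈ A, HZ a (Z⟦k⟧)

noncomputable def sAdd (X : C) (a b c : ℤ) (h : a + b = c) : X⟦a⟧⟦b⟧ ≅ X⟦c⟧ :=
  ((shiftFunctorAdd' C a b c h).app X).symm

noncomputable def sZero (X : C) (a b : ℤ) (h : a + b = 0) : X⟦a⟧⟦b⟧ ≅ X :=
  (shiftFunctorCompIsoId C a b h).app X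

lemma PA.shift {B : Set C} {k : ℤ} {Z : C} (h : PA B k Z) (n l : ℤ) (hl : k + n = l) :
    PA B l (Z⟦n⟧) := fun b hb =>
  ((h b hb).shift n).iso (Iso.refl _) (sAdd b k n l hl)

lemma PB.shift {A : Set C} {k : ℤ} {Z : C} (h : PB A k Z) (n l : ℤ) (hl : n + l = k) :
    PB A l (Z⟦n⟧) := fun a ha =>
  (h a ha).iso (Iso.refl _) (sAdd Z n l k hl).symm

lemma PA.iso {B : Set C} {k : ℤ} {Z Z' : C} (h : PA B k Z) (e : Z ≅ Z') : PA B k Z' :=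
  fun b hb => (h b hb).iso e (Iso.refl _)

lemma PB.iso {A : Set C} {k : ℤ} {Z Z' : C} (h : PB A k Z) (e : Z ≅ Z') : PB A k Z' :=
  fun b hb => (h b hb).iso (Iso.refl _) ((shiftFunctor C k).mapIso e)

lemma PA.ext {B : Set C} {k : ℤ} {X Y Z : C} {f : X ⟶ Y} {g : Y ⟶ Z} {t : Z ⟶ X⟦(1:ℤ)⟧}
    (hT : Triangle.mk f g t ∈ distTriang C) (h1 : PA B k X) (h3 : PA B k Z) : PA B k Y :=
  fun b hb => HZ.mid_left hT (h1 b hb) (h3 b hb)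

lemma PB.ext {A : Set C} {k : ℤ} {X Y Z : C} {f : X ⟶ Y} {g : Y ⟶ Z} {t : Z ⟶ X⟦(1:ℤ)⟧}
    (hT : Triangle.mk f g t ∈ distTriang C) (h1 : PB A k X) (h3 : PB A k Z) : PB A k Y :=
  fun a ha => HZ.mid_right (Triangle.shift_distinguished _ hT k) (h1 a ha) (h3 a ha)

lemma PA.summand {B : Set C} {k : ℤ} {W Z : C} (h : PA B k W) {i : Z ⟶ W} {r : W ⟶ Z}
    (hi : i ≫ r = 𝟙 Z) : PA B k Z := fun b hb f => by
  have : f = i ≫ r ≫ f := by rw [← Category.assoc, hi, Category.id_comp]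
  rw [this, h b hb (r ≫ f), comp_zero]

lemma PB.summand {A : Set C} {k : ℤ} {W Z : C} (h : PB A k W) {i : Z ⟶ W} {r : W ⟶ Z}
    (hi : i ≫ r = 𝟙 Z) : PB A k Z := fun a ha f => by
  have : f = (f ≫ i⟦k⟧') ≫ r⟦k⟧' := by
    rw [Category.assoc, ← Functor.map_comp, hi, CategoryTheory.Functor.map_id, Category.comp_id]
  rw [this, h a ha (f ≫ i⟦k⟧'), zero_comp]

section cot
variable {A B : Set C} (h : IsCotStructure Set.univ A B)
include h

lemma cotPA {k l : ℤ} (hkl : k ≤ l) {Z : C} (hZ : PA B k Z) : PA B l Z := by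
  obtain ⟨n, rfl⟩ := Int.le.dest hkl
  induction n with
  | zero => simpa using hZ
  | succ n ih =>
    intro b hb
    have hb1 : b⟦(1:ℤ)⟧ ∈ B := h.shiftB ⟨b, hb, ⟨Iso.refl _⟩⟩
    exact (ih (by omega) _ hb1).iso (Iso.refl _) (sAdd b _ _ _ (by push_cast; ring))

lemma cotPB {k l : ℤ} (hkl : k ≤ l) {Z : C} (hZ : PB A k Z) : PB A l Z := by
  obtain ⟨n, rfl⟩ := Int.le.dest hkl
  induction n with
  | zero => simpa using hZ
  | succ n ih =>
    intro a ha
    have ha1 : a⟦(-1:ℤ)⟧ ∈ A := h.shiftA ⟨a, ha, ⟨Iso.refl _⟩⟩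
    exact ((ih (by omega) _ ha1).shift 1).iso (sZero a _ _ (by norm_num))
      (sAdd Z _ _ _ (by push_cast; ring))

lemma cot_dec (Z : C) : ∃ (a b : C) (f : b ⟶ a) (g : a ⟶ Z) (t : Z ⟶ b⟦(1:ℤ)⟧),
    a ∈ A ∧ b ∈ B ∧ Triangle.mk f g t ∈ distTriang C := by
  have hz : Z⟦(-1:ℤ)⟧ ∈ star (shf A (-1)) B := by rw [← h.decomp]; trivial
  obtain ⟨a', b, f, g, t, ⟨a, ha, ⟨e⟩⟩, hb, hT⟩ := hz
  have h2 := rot_of_distTriang _ (rot_of_distTriang _ hT)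
  let e2 : Z⟦(-1:ℤ)⟧⟦(1:ℤ)⟧ ≅ Z := sZero Z _ _ (by norm_num)
  refine ⟨a'⟦(1:ℤ)⟧, b, t, -f⟦(1:ℤ)⟧' ≫ e2.hom, -e2.inv ≫ g⟦(1:ℤ)⟧', ?_, hb, ?_⟩
  · exact h.isoA ha ((shiftFunctor C (1:ℤ)).mapIso e ≪≫ sZero a _ _ (by norm_num)).symm
  · refine isomorphic_distinguished _ h2 _ (Triangle.isoMk _ _ (Iso.refl _) (Iso.refl _)
      e2.symm ?_ ?_ ?_)
    · exact (Category.comp_id t).trans (Category.id_comp t).symm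
    · have : (-f⟦(1:ℤ)⟧' ≫ e2.hom) ≫ e2.inv = 𝟙 _ ≫ (-f⟦(1:ℤ)⟧') := by simp
      exact this
    · have : (-e2.inv ≫ g⟦(1:ℤ)⟧') ≫ (𝟙 b)⟦(1:ℤ)⟧' = e2.inv ≫ (-g⟦(1:ℤ)⟧') := by simp
      exact this

lemma cot_memA {Z : C} : Z ∈ A ↔ PA B 1 Z := by
  constructor
  · intro hZ b hb
    have h1 : HZ (Z⟦(-1:ℤ)⟧) b := h.orth _ ⟨Z, hZ, ⟨Iso.refl _⟩⟩ b hb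
    exact (h1.shift 1).iso (sZero Z _ _ (by norm_num)) (Iso.refl _)
  · intro hZ
    obtain ⟨a, b, f, g, t, ha, hb, hT⟩ := cot_dec h Z
    obtain ⟨s, hs⟩ := Triangle.coyoneda_exact₃ _ hT (𝟙 Z) (by
      have := hZ b hb t
      subst this
      exact comp_zero)
    exact h.summandA ha ⟨s, g, hs.symm⟩

lemma cot_memB {Z : C} : Z ∈ B ↔ PB A 1 Z := by
  constructor
  · intro hZ a ha
    have h1 : HZ (a⟦(-1:ℤ)⟧) Z := h.orth _ ⟨a, ha, ⟨Iso.refl _⟩⟩ Z hZ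
    exact (h1.shift 1).iso (sZero a _ _ (by norm_num)) (Iso.refl _)
  · intro hZ
    obtain ⟨a, b, f, g, t, ha, hb, hT⟩ := cot_dec h (Z⟦(1:ℤ)⟧)
    obtain ⟨s, hs⟩ := Triangle.yoneda_exact₃ _ hT (𝟙 (Z⟦(1:ℤ)⟧)) (by
      have := hZ a ha g
      subst this
      exact zero_comp)
    refine h.summandB hb ⟨(shiftFunctor C (1:ℤ)).preimage t,
      (shiftFunctor C (1:ℤ)).preimage s, ?_⟩
    apply (shiftFunctor C (1:ℤ)).map_injective
    rw [CategoryTheory.Functor.map_comp, Functor.map_preimage, CategoryTheory.Functor.map_id]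
    exact (congrArg (t ≫ ·) (Functor.map_preimage _ _)).trans hs.symm

lemma cot_epsHat (n : ℕ) (Z : C) : Z ∈ epsHat A n ↔ PA B (n + 1) Z := by
  induction n generalizing Z with
  | zero => simpa [epsHat] using cot_memA h
  | succ n ih =>
    constructor
    · rintro ⟨W, a, f, g, t, hW, ha, hT⟩
      exact PA.ext (rot_of_distTriang _ hT) (cotPA h (by push_cast; omega) ((cot_memA h).1 ha))
        (((ih W).1 hW).shift 1 _ (by push_cast; ring))
    · intro hZ
      obtain ⟨z, hz, hz0⟩ := h.addA.1
      have e : (0 : C) ≅ z := (isZero_zero C).iso hz0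
      refine ⟨Z⟦(-1:ℤ)⟧, 0, 0, 0, (sZero Z _ _ (by norm_num)).inv, ?_, h.isoA hz e.symm, ?_⟩
      · exact (ih _).2 (hZ.shift _ _ (by push_cast; ring))
      · refine isomorphic_distinguished _ (contractible_distinguished₂ (Z⟦(-1:ℤ)⟧)) _
          (Triangle.isoMk _ _ (Iso.refl _) (Iso.refl _) (sZero Z (-1) 1 (by norm_num)).symm
            ?_ ?_ ?_)
        · exact (isZero_zero C).eq_of_tgt _ _
        · exact (isZero_zero C).eq_of_src _ _
        · have : (sZero Z (-1) 1 (by norm_num)).inv ≫ (𝟙 (Z⟦(-1:ℤ)⟧))⟦(1:ℤ)⟧' =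
              (sZero Z (-1) 1 (by norm_num)).inv ≫ 𝟙 _ := by simp
          exact this

lemma cot_epsCheck (n : ℕ) (Z : C) : Z ∈ epsCheck B n ↔ PB A (n + 1) Z := by
  induction n generalizing Z with
  | zero => simpa [epsCheck] using cot_memB h
  | succ n ih =>
    constructor
    · rintro ⟨b, K, f, g, t, hb, hK, hT⟩
      exact PB.ext (inv_rot_of_distTriang _ hT) (((ih K).1 hK).shift (-1) _ (by push_cast; ring))
        (cotPB h (by push_cast; omega) ((cot_memB h).1 hb))
    · intro hZ
      obtain ⟨z, hz, hz0⟩ := h.addB.1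
      have e : (0 : C) ≅ z := (isZero_zero C).iso hz0
      refine ⟨0, Z⟦(1:ℤ)⟧, 0, 0, 𝟙 _, h.isoB hz e.symm, ?_, contractible_distinguished₂ Z⟩
      exact (ih _).2 (hZ.shift _ _ (by push_cast; ring))

lemma cot_hat (Z : C) : Z ∈ hat A ↔ ∃ k, PA B k Z := by
  simp only [hat, Set.mem_iUnion, cot_epsHat h]
  constructor
  · rintro ⟨n, hn⟩; exact ⟨_, hn⟩
  · rintro ⟨k, hk⟩; exact ⟨k.toNat, cotPA h (by omega) hk⟩

lemma cot_check (Z : C) : Z ∈ check B ↔ ∃ k, PB A k Z := by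
  simp only [check, Set.mem_iUnion, cot_epsCheck h]
  constructor
  · rintro ⟨n, hn⟩; exact ⟨_, hn⟩
  · rintro ⟨k, hk⟩; exact ⟨k.toNat, cotPB h (by omega) hk⟩

lemma cot_id (Z : C) : idDim A Z < ⊤ ↔ ∃ k, PB A k Z := by
  rw [idDim, sInf_lt_iff]
  constructor
  · rintro ⟨_, ⟨m, rfl, hm⟩, -⟩
    exact ⟨m + 1, hm (m + 1) (by omega)⟩
  · rintro ⟨k, hk⟩
    exact ⟨_, ⟨k.toNat, rfl, fun i hi => cotPB h (by omega) hk⟩, ENat.natCast_lt_top _⟩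

lemma cot_pd (Z : C) : pdDim B Z < ⊤ ↔ ∃ k, PA B k Z := by
  rw [pdDim, sInf_lt_iff]
  constructor
  · rintro ⟨_, ⟨m, rfl, hm⟩, -⟩
    refine ⟨m + 1, fun b hb => ?_⟩
    have h1 : HZ (Z⟦(-(m + 1 : ℤ))⟧) b := hm (m + 1) (by omega) b hb
    exact (h1.shift (m + 1)).iso (sZero Z _ _ (by ring)) (Iso.refl _)
  · rintro ⟨k, hk⟩
    refine ⟨_, ⟨k.toNat, rfl, fun i hi b hb => ?_⟩, ENat.natCast_lt_top _⟩
    have h1 : PA B i Z := cotPA h (by omega) hk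
    exact ((h1 b hb).shift (-i)).iso (Iso.refl _) (sZero b _ _ (by ring))

lemma cot_omegaHat (n : ℕ) (Z : C) (hZ : PA B (n + 1) Z) (hB : Z ∈ B) :
    Z ∈ epsHat (A ∩ B) n := by
  induction n generalizing Z with
  | zero => exact ⟨(cot_memA h).2 (by simpa using hZ), hB⟩
  | succ n ih =>
    obtain ⟨a, b, f, g, t, ha, hb, hT⟩ := cot_dec h Z
    have haB : a ∈ B := (cot_memB h).2 (PB.ext hT ((cot_memB h).1 hb) ((cot_memB h).1 hB))
    refine ⟨b, a, f, g, t, ih b ?_ hb, ⟨ha, haB⟩, hT⟩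
    have h1 : PA B (n + 2) (b⟦(1:ℤ)⟧) := by
      refine PA.ext (rot_of_distTriang _ (rot_of_distTriang _ hT))
        (cotPA h (by push_cast; omega) hZ)
        (((cot_memA h).1 ha).shift 1 2 (by norm_num) |> cotPA h (by omega))
    exact (h1.shift (-1) (n + 1) (by ring)).iso (sZero b _ _ (by norm_num))

lemma cot_zero : (0 : C) ∈ A ∩ B := by
  obtain ⟨z, hz, hz0⟩ := h.addA.1
  obtain ⟨z', hz', hz0'⟩ := h.addB.1
  exact ⟨h.isoA hz (hz0.iso (isZero_zero C)), h.isoB hz' (hz0'.iso (isZero_zero C))⟩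

lemma cot_tilde (m : ℕ) (Z : C) (hZ : ∃ k, PA B k Z) (hB : PB A (m + 1) Z) :
    Z ∈ epsCheck (hat (A ∩ B)) m := by
  induction m generalizing Z with
  | zero =>
    obtain ⟨k, hk⟩ := hZ
    exact Set.mem_iUnion.2 ⟨k.toNat, cot_omegaHat h _ _ (cotPA h (by omega) hk)
      ((cot_memB h).2 (by simpa using hB))⟩
  | succ n ih =>
    obtain ⟨k, hk⟩ := hZ
    refine ⟨0, Z⟦(1:ℤ)⟧, 0, 0, 𝟙 _, Set.mem_iUnion.2 ⟨0, cot_zero h⟩, ?_,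
      contractible_distinguished₂ Z⟩
    exact ih _ ⟨_, hk.shift 1 _ rfl⟩ (hB.shift _ _ (by push_cast; ring))

lemma cot_thick_s6 : IsThick {M : C | (∃ k, PA B k M) ∧ ∃ k, PB A k M} where
  zero := ⟨0, ⟨⟨0, fun _ _ f => (isZero_zero C).eq_of_src _ _⟩,
    ⟨0, fun _ _ f => ((shiftFunctor C (0:ℤ)).map_isZero (isZero_zero C)).eq_of_tgt _ _⟩⟩,
      isZero_zero C⟩
  iso := by
    rintro X Y ⟨⟨k, hk⟩, ⟨l, hl⟩⟩ e
    exact ⟨⟨k, hk.iso e⟩, ⟨l, hl.iso e⟩⟩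
  shift := by
    rintro n Y ⟨X, ⟨⟨k, hk⟩, ⟨l, hl⟩⟩, ⟨e⟩⟩
    exact ⟨⟨_, (hk.shift n _ rfl).iso e.symm⟩, ⟨l - n, (hl.shift n _ (by ring)).iso e.symm⟩⟩
  ext := by
    rintro Y ⟨X, Z, f, g, t, ⟨⟨k, hk⟩, ⟨l, hl⟩⟩, ⟨⟨k', hk'⟩, ⟨l', hl'⟩⟩, hT⟩
    exact ⟨⟨max k k', PA.ext hT (cotPA h (le_max_left _ _) hk) (cotPA h (le_max_right _ _) hk')⟩,
      ⟨max l l', PB.ext hT (cotPB h (le_max_left _ _) hl) (cotPB h (le_max_right _ _) hl')⟩⟩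
  summand := by
    rintro W Z ⟨⟨k, hk⟩, ⟨l, hl⟩⟩ ⟨i, r, hi⟩
    exact ⟨⟨k, hk.summand hi⟩, ⟨l, hl.summand hi⟩⟩

end cot

lemma thick_epsHat {S X : Set C} (hS : IsThick S) (hX : X ⊆ S) (n : ℕ) : epsHat X n ⊆ S := by
  induction n with
  | zero => exact hX
  | succ n ih =>
    rintro Z ⟨W, a, f, g, t, hW, ha, hT⟩
    exact hS.ext ⟨_, _, _, _, _, hX ha, hS.shift 1 ⟨W, ih hW, ⟨Iso.refl _⟩⟩,
      rot_of_distTriang _ hT⟩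

lemma thick_epsCheck {S X : Set C} (hS : IsThick S) (hX : X ⊆ S) (n : ℕ) :
    epsCheck X n ⊆ S := by
  induction n with
  | zero => exact hX
  | succ n ih =>
    rintro Z ⟨a, K, f, g, t, ha, hK, hT⟩
    exact hS.ext ⟨_, _, _, _, _, hS.shift (-1) ⟨K, ih hK, ⟨Iso.refl _⟩⟩, hX ha,
      inv_rot_of_distTriang _ hT⟩

lemma thick_tilde {S X : Set C} (hS : IsThick S) (hX : X ⊆ S) : tilde X ⊆ S :=
  Set.iUnion_subset (thick_epsCheck hS (Set.iUnion_subset (thick_epsHat hS hX)))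

/-- If `(A, B)` is a co-t-structure on `T` and `ω := A ∩ B`, then
`Δ̄_T(ω) = ω~ = {C ∈ A^∧ : id_A(C) < ∞} = {C ∈ B^∨ : pd_B(C) < ∞} = A^∧ ∩ B^∨`. -/
theorem stmt6 (A B : Set C) (h : IsCotStructure Set.univ A B) :
    thickClosure (A ∩ B) = tilde (A ∩ B) ∧
    tilde (A ∩ B) = {M : C | M ∈ hat A ∧ idDim A M < ⊤} ∧
    {M : C | M ∈ hat A ∧ idDim A M < ⊤} = {M : C | M ∈ check B ∧ pdDim B M < ⊤} ∧
    {M : C | M ∈ check B ∧ pdDim B M < ⊤} = hat A ∩ check B := by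
  have e2 : {M : C | M ∈ hat A ∧ idDim A M < ⊤} = {M : C | (∃ k, PA B k M) ∧ ∃ k, PB A k M} := by
    ext M; simp only [Set.mem_ofPred_eq, cot_hat h, cot_id h]
  have e3 : {M : C | M ∈ check B ∧ pdDim B M < ⊤} =
      {M : C | (∃ k, PA B k M) ∧ ∃ k, PB A k M} := by
    ext M; simp only [Set.mem_ofPred_eq, cot_check h, cot_pd h]; exact and_comm
  have e4 : hat A ∩ check B = {M : C | (∃ k, PA B k M) ∧ ∃ k, PB A k M} := by
    ext M; simp only [Set.mem_inter_iff, Set.mem_ofPred_eq, cot_check h, cot_hat h]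
  have s1 : tilde (A ∩ B) ⊆ thickClosure (A ∩ B) :=
    Set.subset_sInter fun S hS => thick_tilde hS.1 hS.2
  have s2 : thickClosure (A ∩ B) ⊆ {M : C | (∃ k, PA B k M) ∧ ∃ k, PB A k M} :=
    Set.sInter_subset_of_mem ⟨cot_thick_s6 h, fun M hM =>
      ⟨⟨1, (cot_memA h).1 hM.1⟩, ⟨1, (cot_memB h).1 hM.2⟩⟩⟩
  have s3 : {M : C | (∃ k, PA B k M) ∧ ∃ k, PB A k M} ⊆ tilde (A ∩ B) := by
    rintro M ⟨hA, ⟨k, hk⟩⟩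
    exact Set.mem_iUnion.2 ⟨k.toNat, cot_tilde h _ _ hA (cotPB h (by omega) hk)⟩
  rw [e2, e3, e4]
  exact ⟨(s2.trans s3).antisymm s1, (s1.trans s2).antisymm s3, rfl, rfl⟩

end CotPaper
end
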